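/- arXiv:1206.4707 — 2 statements merged into one kernel-verified Lean document; each statement's English description precedes it below -/
import Mathlib

section
/- (Cartwright–Littlewood theorem under the ∂-nonwandering condition, simply connected plane case.) Let f : ℝ² → ℝ² be an orientation-preserving homeomorphism and U ⊆ ℝ² a bounded open f-invariant simply connected set. Suppose f is ∂-nonwandering in U and the prime ends rotation number ρ(f,U) is zero, i.e. some extension F of f|_U to c_E(U,ℝ²) has a fixed point in b_E(U,ℝ²). Then f has a fixed point in ∂U. -/
open Set Topology Filter

noncomputable section

universe u

variable {X : Type u} [TopologicalSpace X]

/-- A homeomorphism is *orientation preserving* if it is isotopic to the identity. -/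
def IsOrientationPreserving (f : X ≃ₜ X) : Prop :=
  ∃ H : unitInterval × X → X,
    Continuous H ∧ (∀ x, H (0, x) = x) ∧ (∀ x, H (1, x) = f x) ∧
      ∀ t : unitInterval, IsHomeomorph fun x => H (t, x)

/-- `D` is a connected component of `A`. -/
def IsCompOf (A D : Set X) : Prop := ∃ x ∈ A, D = connectedComponentIn A x

/-- `A` has exactly two connected components, the distinct sets `D₁` and `D₂`. -/
def HasTwoComps (A D₁ D₂ : Set X) : Prop :=
  IsCompOf A D₁ ∧ IsCompOf A D₂ ∧ D₁ ≠ D₂ ∧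
    ∀ x ∈ A, connectedComponentIn A x = D₁ ∨ connectedComponentIn A x = D₂

/-- A *cross-cut* of the open set `U`: the image of an arc `g` on `(0,1)`, where `g` is
continuous and injective on `[0,1]`'s interior, runs inside `U`, has endpoints on `∂U`, and
separates `U` into exactly two components, each with a boundary point on `∂U` away from the
closed arc. -/
def IsCrossCut (U γ : Set X) : Prop :=
  ∃ g : ℝ → X,
    ContinuousOn g (Icc 0 1) ∧ InjOn g (Ioo 0 1) ∧ (∀ t ∈ Ioo (0:ℝ) 1, g t ∈ U) ∧
      g 0 ∈ frontier U ∧ g 1 ∈ frontier U ∧ γ = g '' Ioo 0 1 ∧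
      ∃ D₁ D₂ : Set X, HasTwoComps (U \ γ) D₁ D₂ ∧
        (frontier D₁ ∩ (frontier U \ g '' Icc 0 1)).Nonempty ∧
        (frontier D₂ ∩ (frontier U \ g '' Icc 0 1)).Nonempty

/-- A *cross-section* of `U`: a connected component of `U ∖ γ` for a cross-cut `γ`. -/
def IsCrossSection (U D : Set X) : Prop := ∃ γ : Set X, IsCrossCut U γ ∧ IsCompOf (U \ γ) D

/-- The image of a set under the `k`-th integer iterate of a homeomorphism. -/
def iterZ (f : X ≃ₜ X) (k : ℤ) (A : Set X) : Set X := ⇑(f.toEquiv ^ k) '' A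

/-- A cross-section of `U` which is wandering for `f^n`. -/
def IsWanderingSection (f : X ≃ₜ X) (U : Set X) (n : ℕ) (D : Set X) : Prop :=
  IsCrossSection U D ∧ ∀ k : ℤ, k ≠ 0 → iterZ f ((n : ℤ) * k) D ∩ D = ∅

/-- `f` is ∂-nonwandering in `U`. -/
def BdNonwandering (f : X ≃ₜ X) (U : Set X) : Prop :=
  ∀ n : ℕ, 1 ≤ n → ∃ K : Set X, IsCompact K ∧ K ⊆ U ∧
    ∀ D : Set X, IsWanderingSection f U n D →
      (∃ k : ℤ, 0 < k ∧ (iterZ f ((n : ℤ) * k) D ∩ K).Nonempty) ∧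
      (∃ k : ℤ, k < 0 ∧ (iterZ f ((n : ℤ) * k) D ∩ K).Nonempty)

/-- The boundary of `D` inside `U` (for `D` open in `U`). -/
def bdIn (U D : Set X) : Set X := (closure D \ D) ∩ U

/-- A chain of cross-sections of `U`. -/
def IsPEChain (U : Set X) (D : ℕ → Set X) : Prop :=
  (∀ i, IsCrossSection U (D i)) ∧ (∀ i j : ℕ, j ≤ i → D i ⊆ D j) ∧
    ∀ i j : ℕ, i ≠ j → closure (bdIn U (D i)) ∩ closure (bdIn U (D j)) = ∅

/-- The chain `D` divides the cross-section `E`. -/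
def ChainDividesSection (D : ℕ → Set X) (E : Set X) : Prop := ∃ N : ℕ, ∀ i, N ≤ i → D i ⊆ E

/-- The chain `D` divides the chain `D'`. -/
def ChainDivides (D D' : ℕ → Set X) : Prop := ∀ n : ℕ, ∃ m : ℕ, D m ⊆ D' n

/-- A prime chain: a chain dividing every chain that divides it. -/
def IsPrimeChain (U : Set X) (D : ℕ → Set X) : Prop :=
  IsPEChain U D ∧ ∀ D' : ℕ → Set X, IsPEChain U D' → ChainDivides D' D → ChainDivides D D'

/-- The type of prime chains of `U`. -/
def PrimeChain (U : Set X) : Type u := {D : ℕ → Set X // IsPrimeChain U D}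

/-- A prime end of `U`: an equivalence class of prime chains. -/
def PrimeEnd (U : Set X) : Type u :=
  Quot fun C C' : PrimeChain U => ChainDivides C.1 C'.1 ∧ ChainDivides C'.1 C.1

/-- The prime end `p` divides the cross-section `E`. -/
def PrimeEndDivides {U : Set X} (p : PrimeEnd U) (E : Set X) : Prop :=
  ∃ C : PrimeChain U, Quot.mk _ C = p ∧ ChainDividesSection C.1 E

/-- The prime ends compactification of `U` (as a set: `U ⊔ (prime ends)`). -/
def PrimeEndComp (U : Set X) : Type u := ↥U ⊕ PrimeEnd U

/-- A point of `U`, as an element of the prime ends compactification. -/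
def pePt (U : Set X) (x : ↥U) : PrimeEndComp U := Sum.inl x

/-- A prime end, as an element of the prime ends compactification. -/
def peEnd (U : Set X) (p : PrimeEnd U) : PrimeEndComp U := Sum.inr p

/-- The copy of a subset `V ⊆ U` inside the prime ends compactification. -/
def peOpen (U V : Set X) : Set (PrimeEndComp U) := {z | ∃ x : ↥U, z = pePt U x ∧ (x : X) ∈ V}

/-- The basic set `E ∪ i_E(E)` of the prime ends compactification, for a cross-section `E`. -/
def peSection (U E : Set X) : Set (PrimeEndComp U) :=
  peOpen U E ∪ {z | ∃ p : PrimeEnd U, z = peEnd U p ∧ PrimeEndDivides p E}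

/-- The topology of the prime ends compactification. -/
instance primeEndCompTopology (U : Set X) : TopologicalSpace (PrimeEndComp U) :=
  TopologicalSpace.generateFrom
    ({s | ∃ V : Set X, IsOpen V ∧ V ⊆ U ∧ s = peOpen U V} ∪
      {s | ∃ E : Set X, IsCrossSection U E ∧ s = peSection U E})

/-- The circle of prime ends, as a subset of the prime ends compactification. -/
def PrimeEndCircle (U : Set X) : Set (PrimeEndComp U) := Set.range (peEnd U)

/-- `F` is an extension of `f|_U` to the prime ends compactification of `U`. -/
def IsPEExtension (f : X ≃ₜ X) (U : Set X) (F : PrimeEndComp U ≃ₜ PrimeEndComp U) : Prop :=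
  ∀ (x : X) (hx : x ∈ U) (hfx : f x ∈ U), F (pePt U ⟨x, hx⟩) = pePt U ⟨f x, hfx⟩

/-- An end-cut of `U`: an injective arc in `U` defined on `[0,1)` converging in the ambient
space as `t → 1⁻`. -/
def IsEndCut (U : Set X) (γ : ℝ → X) : Prop :=
  ContinuousOn γ (Ico 0 1) ∧ InjOn γ (Ico 0 1) ∧ (∀ t ∈ Ico (0:ℝ) 1, γ t ∈ U) ∧
    ∃ z : X, Tendsto γ (𝓝[<] (1:ℝ)) (𝓝 z)

/-- `z` is an accessible point of `∂U`. -/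
def IsAccessiblePoint (U : Set X) (z : X) : Prop :=
  ∃ γ : ℝ → X, IsEndCut U γ ∧ Tendsto γ (𝓝[<] (1:ℝ)) (𝓝 z)

/-- `p` is an accessible prime end of `U`. -/
def IsAccessiblePrimeEnd (U : Set X) (p : PrimeEnd U) : Prop :=
  ∃ (γ : ℝ → X) (hγ : ∀ t ∈ Ico (0:ℝ) 1, γ t ∈ U), IsEndCut U γ ∧
    Tendsto (fun t : ↥(Ico (0:ℝ) 1) => pePt U ⟨γ ↑t, hγ ↑t t.2⟩)
      (comap Subtype.val (𝓝[<] (1:ℝ))) (𝓝 (peEnd U p))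

/-- A translation arc for `f` based at `x`: a simple arc from `x` to `f x` meeting its image
only as allowed. -/
def IsTranslationArc (f : X ≃ₜ X) (γ : Set X) (x : X) : Prop :=
  f x ≠ x ∧
    ∃ g : ℝ → X, ContinuousOn g (Icc 0 1) ∧ InjOn g (Icc 0 1) ∧
      g 0 = x ∧ g 1 = f x ∧ γ = g '' Icc 0 1 ∧
      ((⇑f '' γ) ∩ γ = {f x} ∨ ((⇑f '' γ) ∩ γ = {x, f x} ∧ f (f x) = x))

/-- An `N`-translation arc for `f` based at `x` (for `N = 1` this is just a translation arc). -/
def IsNTranslationArc (f : X ≃ₜ X) (N : ℕ) (γ : Set X) (x : X) : Prop :=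
  IsTranslationArc f γ x ∧
    (2 ≤ N →
      (∀ k : ℕ, 2 ≤ k → k ≤ N - 1 → (⇑f)^[k] '' γ ∩ γ = ∅) ∧
        ((⇑f)^[N] '' γ ∩ γ = ∅ ∨ ((⇑f)^[N] '' γ ∩ γ = {x} ∧ (⇑f)^[N + 1] x = x)))

/-- An ∞-translation arc: an `N`-translation arc for every `N ≥ 1`. -/
def IsInfTranslationArc (f : X ≃ₜ X) (γ : Set X) (x : X) : Prop :=
  ∀ N : ℕ, 1 ≤ N → IsNTranslationArc f N γ x

/-- A nonwandering homeomorphism. -/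
def IsNonwanderingMap (f : X → X) : Prop :=
  ∀ V : Set X, IsOpen V → V.Nonempty → ∃ n : ℕ, 1 ≤ n ∧ (f^[n] '' V ∩ V).Nonempty

/-- A loop contained in `A` which is not null-homotopic in `V`. -/
def IsEssentialLoopIn (V A : Set X) : Prop :=
  ∃ (z : ↥V) (δ : Path z z), (∀ t : unitInterval, (↑(δ t) : X) ∈ A) ∧
    ¬ δ.Homotopic (Path.refl z)

/-- An annular continuum: a continuum with an open annular neighborhood `V` such that `V ∖ K`
has exactly two components, each essential in `V`. -/
def IsAnnularContinuum (K : Set X) : Prop :=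
  IsCompact K ∧ IsConnected K ∧ K.Nontrivial ∧
    ∃ V : Set X, IsOpen V ∧ K ⊆ V ∧
      Nonempty (↥V ≃ₜ AddCircle (1 : ℝ) × ↥(Ioo (0 : ℝ) 1)) ∧
      ∃ D₁ D₂ : Set X, HasTwoComps (V \ K) D₁ D₂ ∧
        IsEssentialLoopIn V D₁ ∧ IsEssentialLoopIn V D₂

/-- A set contractible in the ambient surface: it has an open neighborhood homeomorphic to the
plane. -/
def ContractibleInSurface (K : Set X) : Prop :=
  ∃ W : Set X, IsOpen W ∧ K ⊆ W ∧ Nonempty (↥W ≃ₜ (ℝ × ℝ))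

/-- `α ∈ ℝ/ℤ` is rational. -/
def IsRationalAC (α : AddCircle (1 : ℝ)) : Prop := ∃ r : ℚ, α = ((r : ℝ) : AddCircle (1 : ℝ))

/-- The constant `q(α,g)`: the smallest positive integer `q` with `‖qα‖ = 0` if `α` is
rational, and `(2g+1)‖qα‖ < ‖α‖` if `α` is irrational. -/
def qConst (α : AddCircle (1 : ℝ)) (g : ℕ) : ℕ :=
  sInf {q : ℕ | 0 < q ∧
    ((IsRationalAC α ∧ ‖q • α‖ = 0) ∨
      (¬IsRationalAC α ∧ ((2 * g + 1 : ℕ) : ℝ) * ‖q • α‖ < ‖α‖))}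


theorem isDiscrete_range_intCast_real : IsDiscrete (range ((↑) : ℤ → ℝ)) := by
  have h := Int.isClosedEmbedding_coe_real.isEmbedding
  have := h.toHomeomorph.symm.isEmbedding.discreteTopology
  exact ⟨this⟩

theorem eq_of_exp_eq_exp_mul_I {A : Set X} (hA : IsPreconnected A) {L : X → ℂ} {θ : X → ℝ}
    (hL : ContinuousOn L A) (hθ : ContinuousOn θ A)
    (h : ∀ y ∈ A, Complex.exp (L y) = Complex.exp (θ y * Complex.I)) {x y : X}
    (hx : x ∈ A) (hy : y ∈ A) : (L x).im - θ x = (L y).im - θ y := by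
  have hpi := Real.pi_pos
  have key : ∀ y ∈ A, ((L y).im - θ y) / (2 * Real.pi) ∈ range ((↑) : ℤ → ℝ) := by
    intro y hy
    obtain ⟨n, hn⟩ := Complex.exp_eq_exp_iff_exists_int.1 (h y hy)
    refine ⟨n, ?_⟩
    have := congrArg Complex.im hn
    simp at this
    rw [this]
    field_simp
    ring
  have hc : ContinuousOn (fun y => ((L y).im - θ y) / (2 * Real.pi)) A := by
    have := Complex.continuous_im.comp_continuousOn hL
    exact (this.sub hθ).div_const _
  have := hA.constant_of_mapsTo isDiscrete_range_intCast_real hc key hx hy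
  have h2 : (2 * Real.pi) ≠ 0 := by positivity
  simpa [div_left_inj' h2] using this

/-- Two angle functions for a nonvanishing map on a simply connected plane domain, defined on
connected sets covering the domain, differ by a constant on the overlap. -/
theorem angle_sub_eq {U : Set ℂ} (hU : IsOpen U) (hsc : IsSimplyConnected U) {A B : Set ℂ}
    (hA : IsPreconnected A) (hB : IsPreconnected B) (hAB : A ∪ B = U) {g : ℂ → ℂ}
    (hg : ContinuousOn g U) {α β : ℂ → ℝ} (hα : ContinuousOn α A) (hβ : ContinuousOn β B)
    (hgA : ∀ y ∈ A, g y = Complex.exp (α y * Complex.I))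
    (hgB : ∀ y ∈ B, g y = Complex.exp (β y * Complex.I)) {x y : ℂ}
    (hx : x ∈ A ∩ B) (hy : y ∈ A ∩ B) : α x - β x = α y - β y := by
  have h0 : (0 : ℂ) ∉ g '' U := by
    rintro ⟨y, hy, h⟩
    rw [← hAB] at hy
    rcases hy with hy | hy
    · rw [hgA y hy] at h; exact Complex.exp_ne_zero _ h
    · rw [hgB y hy] at h; exact Complex.exp_ne_zero _ h
  obtain ⟨L, hL, hLg⟩ := Complex.exists_continuousOn_eqOn_exp_comp hsc hU hg h0
  have hAU : A ⊆ U := hAB ▸ subset_union_left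
  have hBU : B ⊆ U := hAB ▸ subset_union_right
  have e1 := eq_of_exp_eq_exp_mul_I hA (hL.mono hAU) hα
    (fun y hy => (hLg (hAU hy)).trans (hgA y hy)) hx.1 hy.1
  have e2 := eq_of_exp_eq_exp_mul_I hB (hL.mono hBU) hβ
    (fun y hy => (hLg (hBU hy)).trans (hgB y hy)) hx.2 hy.2
  linarith

/-- Urysohn functions for disjoint relatively closed sets. -/
theorem exists_urysohnOn {U P Q : Set ℂ} (hP : closure P ∩ U ⊆ P) (hQ : closure Q ∩ U ⊆ Q)
    (hQU : Q ⊆ U)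
    (hPQ : Disjoint P Q) (hPn : P.Nonempty) (hQn : Q.Nonempty) :
    ∃ u : ℂ → ℝ, ContinuousOn u U ∧ (∀ x ∈ P, u x = 0) ∧ ∀ x ∈ Q, u x = 1 := by
  refine ⟨fun x => Metric.infDist x P / (Metric.infDist x P + Metric.infDist x Q), ?_, ?_, ?_⟩
  · refine (Metric.continuous_infDist_pt _).continuousOn.div
      ((Metric.continuous_infDist_pt _).add (Metric.continuous_infDist_pt _)).continuousOn ?_
    intro x hx h
    have h1 : Metric.infDist x P = 0 := by
      linarith [Metric.infDist_nonneg (x := x) (s := P), Metric.infDist_nonneg (x := x) (s := Q)]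
    have h2 : Metric.infDist x Q = 0 := by linarith
    rw [← Metric.mem_closure_iff_infDist_zero hPn] at h1
    rw [← Metric.mem_closure_iff_infDist_zero hQn] at h2
    exact disjoint_left.1 hPQ (hP ⟨h1, hx⟩) (hQ ⟨h2, hx⟩)
  · intro x hx
    simp [Metric.infDist_zero_of_mem hx]
  · intro x hx
    have h2 : Metric.infDist x Q = 0 := Metric.infDist_zero_of_mem hx
    have hxP : Metric.infDist x P ≠ 0 := by
      intro h
      rw [← Metric.mem_closure_iff_infDist_zero hPn] at h
      exact disjoint_left.1 hPQ (hP ⟨h, hQU hx⟩) hx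
    simp only [h2, add_zero]
    exact div_self hxP

theorem continuousOn_glue_closed {U A B : Set ℂ} (hA : closure A ∩ U ⊆ A) (hB : closure B ∩ U ⊆ B)
    (hAB : A ∪ B = U) {g a b : ℂ → ℂ} (ha : ContinuousOn a A) (hb : ContinuousOn b B)
    (hga : EqOn g a A) (hgb : EqOn g b B) : ContinuousOn g U := by
  have key : ∀ {C : Set ℂ} {c : ℂ → ℂ}, closure C ∩ U ⊆ C → ContinuousOn c C → EqOn g c C →
      ∀ x ∈ U, ContinuousWithinAt g C x := by
    intro C c hC hc hgc x hx
    by_cases hxC : x ∈ C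
    · exact (hc x hxC).congr hgc (hgc hxC)
    · have : x ∉ closure C := fun h => hxC (hC ⟨h, hx⟩)
      rw [ContinuousWithinAt, notMem_closure_iff_nhdsWithin_eq_bot.1 this]
      exact tendsto_bot
  intro x hx
  have := (key hA ha hga x hx).union (key hB hb hgb x hx)
  rwa [hAB] at this

/-- In a simply connected plane domain, relatively closed connected sets covering the domain have
connected intersection. -/
theorem IsPreconnected.inter_of_relClosed {U : Set ℂ} (hU : IsOpen U) (hsc : IsSimplyConnected U)
    {A B : Set ℂ} (hA : IsPreconnected A) (hB : IsPreconnected B) (hAB : A ∪ B = U)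
    (hAc : closure A ∩ U ⊆ A) (hBc : closure B ∩ U ⊆ B) : IsPreconnected (A ∩ B) := by
  have hAU : A ⊆ U := hAB ▸ subset_union_left
  have hBU : B ⊆ U := hAB ▸ subset_union_right
  rw [isPreconnected_closed_iff]
  intro t t' ht ht' hsub hn hn'
  by_contra hne
  rw [not_nonempty_iff_eq_empty] at hne
  have relc : ∀ {t : Set ℂ}, IsClosed t → closure (A ∩ B ∩ t) ∩ U ⊆ A ∩ B ∩ t := by
    intro t ht x hx
    have hs : ∀ s : Set ℂ, A ∩ B ∩ t ⊆ s → x ∈ closure s := fun s hs => closure_mono hs hx.1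
    refine ⟨⟨hAc ⟨hs A (fun y hy => hy.1.1), hx.2⟩, hBc ⟨hs B (fun y hy => hy.1.2), hx.2⟩⟩, ?_⟩
    exact ht.closure_eq ▸ hs t (fun y hy => hy.2)
  obtain ⟨u, hu, hu0, hu1⟩ := exists_urysohnOn (U := U) (relc ht) (relc ht')
    (fun y hy => hAU hy.1.1) (by
      rw [disjoint_left]
      intro x hx hx'
      have : x ∈ A ∩ B ∩ (t ∩ t') := ⟨hx.1, hx.2, hx'.2⟩
      rw [hne] at this
      exact this) hn hn'
  classical
  let a : ℂ → ℂ := fun y => Complex.exp (((Real.pi * u y : ℝ) : ℂ) * Complex.I)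
  let b : ℂ → ℂ := fun y => Complex.exp (((-(Real.pi * u y) : ℝ) : ℂ) * Complex.I)
  let g : ℂ → ℂ := A.piecewise a b
  have hpu : ContinuousOn (fun y => Real.pi * u y) U := continuousOn_const.mul hu
  have hga : EqOn g a A := fun y hy => Set.piecewise_eq_of_mem _ _ _ hy
  have hgb : EqOn g b B := by
    intro y hy
    by_cases hyA : y ∈ A
    · rw [hga hyA]
      rcases hsub ⟨hyA, hy⟩ with h | h
      · simp [a, b, hu0 y ⟨⟨hyA, hy⟩, h⟩]
      · simp [a, b, hu1 y ⟨⟨hyA, hy⟩, h⟩, Complex.exp_neg]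
    · exact Set.piecewise_eq_of_notMem _ _ _ hyA
  have hexp : ∀ {θ : ℂ → ℝ} {s : Set ℂ}, ContinuousOn θ s →
      ContinuousOn (fun y => Complex.exp ((θ y : ℂ) * Complex.I)) s := by
    intro θ s h
    exact Complex.continuous_exp.comp_continuousOn
      ((Complex.continuous_ofReal.comp_continuousOn h).mul continuousOn_const)
  have hg : ContinuousOn g U := continuousOn_glue_closed hAc hBc hAB
    (hexp (hpu.mono hAU)) (hexp (hpu.mono hBU).neg) hga hgb
  obtain ⟨x, hx⟩ := hn
  obtain ⟨y, hy⟩ := hn'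
  have := angle_sub_eq hU hsc hA hB hAB hg (hpu.mono hAU) (hpu.mono hBU).neg hga hgb hx.1 hy.1
  simp only [Pi.neg_apply, hu0 x hx, hu1 y hy] at this
  linarith [Real.pi_pos]

/-- In a simply connected plane domain, open connected sets covering the domain have
connected intersection. -/
theorem IsPreconnected.inter_of_isOpen {U : Set ℂ} (hU : IsOpen U) (hsc : IsSimplyConnected U)
    {A B : Set ℂ} (hA : IsPreconnected A) (hB : IsPreconnected B) (hAB : A ∪ B = U)
    (hAo : IsOpen A) (hBo : IsOpen B) : IsPreconnected (A ∩ B) := by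
  have hAU : A ⊆ U := hAB ▸ subset_union_left
  have hBU : B ⊆ U := hAB ▸ subset_union_right
  rcases (U \ B).eq_empty_or_nonempty with hUB | hUB
  · rw [sdiff_eq_empty] at hUB
    rwa [inter_eq_left.2 (hAU.trans hUB)]
  rcases (U \ A).eq_empty_or_nonempty with hUA | hUA
  · rw [sdiff_eq_empty] at hUA
    rwa [inter_eq_right.2 (hBU.trans hUA)]
  have relc : ∀ {t : Set ℂ}, IsOpen t → closure (U \ t) ∩ U ⊆ U \ t := by
    intro t ht x hx
    refine ⟨hx.2, fun hxt => ?_⟩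
    obtain ⟨y, hy, hy'⟩ := mem_closure_iff.1 hx.1 t ht hxt
    exact hy'.2 hy
  obtain ⟨φ, hφ, hφ0, hφ1⟩ := exists_urysohnOn (U := U) (relc hBo) (relc hAo)
    sdiff_subset (by
      rw [disjoint_left]
      rintro x ⟨hx, hxB⟩ ⟨-, hxA⟩
      rw [← hAB] at hx
      exact hx.elim hxA hxB) hUB hUA
  intro t t' ht ht' hsub hn hn'
  by_contra hne
  rw [not_nonempty_iff_eq_empty] at hne
  classical
  let s : ℂ → ℝ := fun x => if x ∈ t' then -1 else 1
  have hs1 : ∀ x, ‖s x‖ = 1 := by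
    intro x
    simp only [s]; split_ifs <;> simp
  have hst : ∀ x ∈ A ∩ B ∩ t, ∀ᶠ y in 𝓝 x, s y = 1 := by
    intro x hx
    filter_upwards [((hAo.inter hBo).inter ht).mem_nhds hx] with y hy
    have : y ∉ t' := fun h => by
      have : y ∈ A ∩ B ∩ (t ∩ t') := ⟨hy.1, hy.2, h⟩
      rwa [hne] at this
    simp [s, this]
  have hst' : ∀ x ∈ A ∩ B ∩ t', ∀ᶠ y in 𝓝 x, s y = -1 := by
    intro x hx
    filter_upwards [ht'.mem_nhds hx.2] with y hy
    simp [s, hy]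
  have hsc' : ∀ x ∈ A ∩ B, ContinuousAt s x := by
    intro x hx
    rcases hsub hx with h | h
    · exact continuousAt_const.congr (EventuallyEq.symm (hst x ⟨hx, h⟩))
    · exact continuousAt_const.congr (EventuallyEq.symm (hst' x ⟨hx, h⟩))
  have hmul : ∀ {ψ : ℂ → ℝ} {V : Set ℂ}, V ⊆ U → ContinuousOn ψ U →
      (∀ x ∈ V, x ∉ A ∩ B → ψ x = 0) → ContinuousOn (fun x => ψ x * s x) V := by
    intro ψ V hV hψ h0 x hx
    by_cases hxAB : x ∈ A ∩ B
    · exact ((hψ x (hV hx)).mono hV).mul (hsc' x hxAB).continuousWithinAt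
    · have hz := h0 x hx hxAB
      have h2 : Tendsto ψ (𝓝[V] x) (𝓝 0) := by
        have := (hψ x (hV hx)).mono hV
        rwa [ContinuousWithinAt, hz] at this
      rw [ContinuousWithinAt, hz, zero_mul]
      refine squeeze_zero_norm (fun y => ?_) (tendsto_norm_zero.comp h2)
      simp [norm_mul, hs1 y, Function.comp]
  let α : ℂ → ℝ := fun x => Real.pi * (φ x * s x)
  let β : ℂ → ℝ := fun x => Real.pi + Real.pi * ((φ x - 1) * s x)
  have hα : ContinuousOn α A := continuousOn_const.mul (hmul hAU hφ (by
    intro x hx hxAB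
    exact hφ0 x ⟨hAU hx, fun h => hxAB ⟨hx, h⟩⟩))
  have hβ : ContinuousOn β B := continuousOn_const.add (continuousOn_const.mul
    (hmul hBU (hφ.sub continuousOn_const) (by
      intro x hx hxAB
      simp [hφ1 x ⟨hBU hx, fun h => hxAB ⟨h, hx⟩⟩])))
  let a : ℂ → ℂ := fun y => Complex.exp ((α y : ℂ) * Complex.I)
  let b : ℂ → ℂ := fun y => Complex.exp ((β y : ℂ) * Complex.I)
  let g : ℂ → ℂ := A.piecewise a b
  have hga : EqOn g a A := fun y hy => Set.piecewise_eq_of_mem _ _ _ hy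
  have hαt : ∀ y ∈ A ∩ B ∩ t, α y - β y = 0 := by
    intro y hy
    have := (hst y hy).self_of_nhds
    simp only [α, β, this]; ring
  have hαt' : ∀ y ∈ A ∩ B ∩ t', α y - β y = - (2 * Real.pi) := by
    intro y hy
    have := (hst' y hy).self_of_nhds
    simp only [α, β, this]; ring
  have hgb : EqOn g b B := by
    intro y hy
    by_cases hyA : y ∈ A
    · rw [hga hyA]
      rcases hsub ⟨hyA, hy⟩ with h | h
      · have := hαt y ⟨⟨hyA, hy⟩, h⟩
        simp only [a, b, sub_eq_zero.1 this]
      · have := hαt' y ⟨⟨hyA, hy⟩, h⟩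
        have e : α y = β y - 2 * Real.pi := by linarith
        simp only [a, b, e]
        push_cast
        rw [sub_mul, Complex.exp_sub, Complex.exp_two_pi_mul_I, div_one]
    · exact Set.piecewise_eq_of_notMem _ _ _ hyA
  have hexp : ∀ {θ : ℂ → ℝ} {s : Set ℂ}, ContinuousOn θ s →
      ContinuousOn (fun y => Complex.exp ((θ y : ℂ) * Complex.I)) s := by
    intro θ s h
    exact Complex.continuous_exp.comp_continuousOn
      ((Complex.continuous_ofReal.comp_continuousOn h).mul continuousOn_const)
  have hg : ContinuousOn g U := by
    rw [← hAB]
    exact (((hexp hα).congr hga)).union_of_isOpen ((hexp hβ).congr hgb) hAo hBo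
  obtain ⟨x, hx⟩ := hn
  obtain ⟨y, hy⟩ := hn'
  have := angle_sub_eq hU hsc hA hB hAB hg hα hβ hga hgb hx.1 hy.1
  rw [hαt x hx, hαt' y hy] at this
  linarith [Real.pi_pos]

theorem IsPreconnected.exists_mem_frontier {U V : Set X} (hU : IsPreconnected U)
    (h1 : (U ∩ V).Nonempty) (h2 : (U \ V).Nonempty) : (U ∩ frontier V).Nonempty := by
  by_contra hne
  rw [not_nonempty_iff_eq_empty] at hne
  have hf : ∀ x ∈ U, x ∉ frontier V := fun x hx h => by
    have : x ∈ U ∩ frontier V := ⟨hx, h⟩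
    rwa [hne] at this
  obtain ⟨a, haU, haV⟩ := h1
  obtain ⟨b, hbU, hbV⟩ := h2
  have hclosed : ∀ x ∈ U, x ∈ closure V → x ∈ interior V := fun x hx h => by
    by_contra h'
    exact hf x hx ⟨h, h'⟩
  obtain ⟨x, hx, hx1, hx2⟩ := hU (interior V) (closure V)ᶜ isOpen_interior
    isClosed_closure.isOpen_compl (fun x hx => by
      by_cases h : x ∈ closure V
      · exact Or.inl (hclosed x hx h)
      · exact Or.inr h) ⟨a, haU, hclosed a haU (subset_closure haV)⟩
    ⟨b, hbU, fun h => hbV (interior_subset (hclosed b hbU h))⟩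
  exact hx2 (subset_closure (interior_subset hx1))

theorem IsPreconnected.subset_of_disjoint_frontier {U V : Set X} (hU : IsPreconnected U)
    (h1 : (U ∩ V).Nonempty) (h2 : U ∩ frontier V = ∅) : U ⊆ V := by
  by_contra h
  have h3 : (U \ V).Nonempty := by
    rw [sdiff_nonempty]; exact h
  exact (hU.exists_mem_frontier h1 h3).ne_empty h2

theorem mem_connectedComponentIn_of_mem_closure [LocallyConnectedSpace X] {W : Set X}
    (hW : IsOpen W) {x y : X} (hy : y ∈ closure (connectedComponentIn W x)) (hyW : y ∈ W) :
    y ∈ connectedComponentIn W x := by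
  obtain ⟨p, hp, hp'⟩ := mem_closure_iff.1 hy _ (hW.connectedComponentIn (x := y))
    (mem_connectedComponentIn hyW)
  rw [connectedComponentIn_eq hp', ← connectedComponentIn_eq hp]
  exact mem_connectedComponentIn hyW

theorem notMem_of_mem_frontier_connectedComponentIn [LocallyConnectedSpace X] {W : Set X}
    (hW : IsOpen W) {x y : X} (hy : y ∈ frontier (connectedComponentIn W x)) : y ∉ W := by
  intro hyW
  have h := mem_connectedComponentIn_of_mem_closure hW hy.1 hyW
  exact hy.2 (by rwa [hW.connectedComponentIn.interior_eq])

theorem subset_connectedComponentIn_of_mem {W S : Set X} (hS : IsPreconnected S)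
    (hSW : S ⊆ W) {x y : X} (hy : y ∈ S) (hyx : y ∈ connectedComponentIn W x) :
    S ⊆ connectedComponentIn W x := by
  rw [connectedComponentIn_eq hyx]
  exact hS.subset_connectedComponentIn hy hSW

/-- Removing from a connected open set a component of the complement of a connected subset
leaves a connected set. -/
theorem isPreconnected_diff_connectedComponentIn [LocallyConnectedSpace X] {U A : Set X}
    (hU : IsPreconnected U) (hA : IsPreconnected A) (hAU : A ⊆ U)
    (hAn : A.Nonempty) (hUA : IsOpen (U \ A)) (z : X) :
    IsPreconnected (U \ connectedComponentIn (U \ A) z) := by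
  obtain ⟨a, ha⟩ := hAn
  have hsub : ∀ x, connectedComponentIn (U \ A) x ⊆ U \ A := fun x => connectedComponentIn_subset _ _
  have hA' : A ⊆ U \ connectedComponentIn (U \ A) z :=
    fun x hx => ⟨hAU hx, fun h => (hsub z h).2 hx⟩
  refine isPreconnected_of_forall a fun y hy => ?_
  by_cases hyA : y ∈ A
  · exact ⟨A, hA', ha, hyA, hA⟩
  have hyW : y ∈ U \ A := ⟨hy.1, hyA⟩
  obtain ⟨x, hxU, hxf⟩ := hU.exists_mem_frontier (V := connectedComponentIn (U \ A) y)
    ⟨y, hy.1, mem_connectedComponentIn hyW⟩ ⟨a, hAU ha, fun h => (hsub y h).2 ha⟩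
  have hxA : x ∈ A := by
    by_contra hxA
    exact notMem_of_mem_frontier_connectedComponentIn hUA hxf ⟨hxU, hxA⟩
  have h1 : IsPreconnected (insert x (connectedComponentIn (U \ A) y)) :=
    isPreconnected_connectedComponentIn.subset_closure (subset_insert _ _)
      (insert_subset hxf.1 subset_closure)
  refine ⟨A ∪ insert x (connectedComponentIn (U \ A) y), ?_, Or.inl ha,
    Or.inr (Or.inr (mem_connectedComponentIn hyW)), hA.union x hxA (mem_insert _ _) h1⟩
  refine union_subset hA' (insert_subset (hA' hxA) fun p hp => ⟨(hsub y hp).1, fun hpz => hy.2 ?_⟩)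
  rw [connectedComponentIn_eq hpz, ← connectedComponentIn_eq hp]
  exact mem_connectedComponentIn hyW

/-- The component through `x` of the part in `U` of the circle around `w` through `x`. -/
def gate (U : Set ℂ) (w x : ℂ) : Set ℂ := connectedComponentIn (Metric.sphere w (dist x w) ∩ U) x

/-- The component of `z` in `U` minus `c`. -/
def sideOf (U c : Set ℂ) (z : ℂ) : Set ℂ := connectedComponentIn (U \ c) z

theorem gate_subset {U : Set ℂ} {w x : ℂ} : gate U w x ⊆ U :=
  (connectedComponentIn_subset _ _).trans inter_subset_right

theorem gate_subset_sphere {U : Set ℂ} {w x : ℂ} : gate U w x ⊆ Metric.sphere w (dist x w) :=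
  (connectedComponentIn_subset _ _).trans inter_subset_left

theorem mem_gate {U : Set ℂ} {w x : ℂ} (hx : x ∈ U) : x ∈ gate U w x :=
  mem_connectedComponentIn ⟨rfl, hx⟩

theorem isPreconnected_gate {U : Set ℂ} {w x : ℂ} : IsPreconnected (gate U w x) :=
  isPreconnected_connectedComponentIn

theorem exists_gate_separating {U : Set ℂ} (hU : IsOpen U) (hsc : IsSimplyConnected U)
    {y z w : ℂ} (hy : y ∈ U) (hz : z ∈ U) {r : ℝ} (hyr : dist y w < r) (hzr : r < dist z w) :
    ∃ x ∈ U, dist x w = r ∧ y ∉ sideOf U (gate U w x) z := by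
  have hUc : IsPreconnected U := hsc.isPathConnected.isConnected.isPreconnected
  set E := Metric.sphere w r ∩ U with hE
  have hUE : U \ E = U \ Metric.sphere w r := by
    ext x; simp only [hE, Set.mem_sdiff, mem_inter_iff]; tauto
  have hUEo : IsOpen (U \ E) := hUE ▸ hU.sdiff Metric.isClosed_sphere
  set W := connectedComponentIn (U \ E) y with hWdef
  have hyE : y ∈ U \ E := ⟨hy, fun h => by have := h.1; rw [Metric.mem_sphere] at this; linarith⟩
  have hyW : y ∈ W := mem_connectedComponentIn hyE
  have hWo : IsOpen W := hUEo.connectedComponentIn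
  have hWs : W ⊆ U \ E := connectedComponentIn_subset _ _
  have hWpre : IsPreconnected W := isPreconnected_connectedComponentIn
  have hWb : W ⊆ Metric.ball w r := by
    refine hWpre.subset_of_disjoint_frontier ⟨y, hyW, hyr⟩ ?_
    rw [eq_empty_iff_forall_notMem]
    rintro x ⟨hx, hxf⟩
    have := hWs hx
    rw [hUE] at this
    exact this.2 (Metric.frontier_ball_subset_sphere hxf)
  have hWcb : closure W ⊆ Metric.closedBall w r :=
    closure_minimal (hWb.trans Metric.ball_subset_closedBall) Metric.isClosed_closedBall
  have hzW : z ∈ U \ closure W := ⟨hz, fun h => by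
    have := hWcb h; rw [Metric.mem_closedBall] at this; linarith⟩
  set A := closure W ∩ U with hAdef
  have hWA : W ⊆ A := fun x hx => ⟨subset_closure hx, (hWs hx).1⟩
  have hApre : IsPreconnected A := hWpre.subset_closure hWA inter_subset_left
  have hUA : U \ A = U \ closure W := by
    ext x; simp only [hAdef, Set.mem_sdiff, mem_inter_iff]; tauto
  have hUAo : IsOpen (U \ A) := hUA ▸ hU.sdiff isClosed_closure
  set V := connectedComponentIn (U \ A) z with hVdef
  have hVo : IsOpen V := hUAo.connectedComponentIn
  have hzV : z ∈ V := mem_connectedComponentIn (hUA ▸ hzW)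
  have hVs : V ⊆ U \ A := connectedComponentIn_subset _ _
  have hyV : y ∉ V := fun h => (hVs h).2 (hWA hyW)
  have hUV : IsPreconnected (U \ V) :=
    isPreconnected_diff_connectedComponentIn hUc hApre inter_subset_right ⟨y, hWA hyW⟩ hUAo z
  have hB : IsPreconnected (closure V ∩ U) :=
    isPreconnected_connectedComponentIn.subset_closure
      (fun x hx => ⟨subset_closure hx, (hVs hx).1⟩) inter_subset_left
  have hI := IsPreconnected.inter_of_relClosed hU hsc hUV hB (by
      ext x
      constructor
      · rintro (h | h)
        exacts [h.1, h.2]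
      · intro h
        by_cases hx : x ∈ V
        · exact Or.inr ⟨subset_closure hx, h⟩
        · exact Or.inl ⟨h, hx⟩)
    (by
      rintro x ⟨hx, hxU⟩
      refine ⟨hxU, fun hxV => ?_⟩
      obtain ⟨p, hp, hp'⟩ := mem_closure_iff.1 hx V hVo hxV
      exact hp'.2 hp)
    (by
      rintro x ⟨hx, hxU⟩
      exact ⟨by simpa using closure_mono inter_subset_left hx, hxU⟩)
  have hIeq : (U \ V) ∩ (closure V ∩ U) = U ∩ frontier V := by
    rw [hVo.frontier_eq]
    ext x; simp only [mem_inter_iff, Set.mem_sdiff]; tauto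
  rw [hIeq] at hI
  obtain ⟨x, hx⟩ := hUc.exists_mem_frontier (V := V) ⟨z, hz, hzV⟩ ⟨y, hy, hyV⟩
  have hFE : U ∩ frontier V ⊆ E := by
    rintro p ⟨hpU, hp⟩
    have h1 : p ∈ A := by
      by_contra h
      exact notMem_of_mem_frontier_connectedComponentIn hUAo hp ⟨hpU, h⟩
    have h2 : p ∉ W := by
      intro h
      obtain ⟨q, hq, hq'⟩ := mem_closure_iff.1 hp.1 W hWo h
      exact (hVs hq').2 (hWA hq)
    by_contra h3
    exact h2 (mem_connectedComponentIn_of_mem_closure hUEo h1.1 ⟨hpU, h3⟩)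
  have hxr : dist x w = r := (hFE hx).1
  refine ⟨x, hx.1, hxr, fun hyc => hyV ?_⟩
  have hFc : U ∩ frontier V ⊆ gate U w x := by
    rw [gate, hxr]
    exact hI.subset_connectedComponentIn hx hFE
  have hzc : z ∈ U \ gate U w x := ⟨hz, fun h => by
    have := gate_subset_sphere h
    rw [Metric.mem_sphere] at this
    linarith⟩
  have hpc : IsPreconnected (sideOf U (gate U w x) z) := isPreconnected_connectedComponentIn
  refine hpc.subset_of_disjoint_frontier ⟨z, mem_connectedComponentIn hzc, hzV⟩ ?_ hyc
  rw [eq_empty_iff_forall_notMem]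
  rintro p ⟨hp, hpf⟩
  have := connectedComponentIn_subset _ _ hp
  exact this.2 (hFc ⟨this.1, hpf⟩)

theorem exists_circleMap_notMem {U : Set ℂ} (hU : IsOpen U) (hsc : IsSimplyConnected U)
    {w : ℂ} (hw : w ∉ U) {r : ℝ} (hr : 0 < r) : ∃ θ : ℝ, circleMap w r θ ∉ U := by
  by_contra! hall
  obtain ⟨L, hL, hLg⟩ := Complex.exists_continuousOn_eqOn_exp_comp hsc hU
    (g := fun x => x - w) (by fun_prop) (by
      rintro ⟨x, hx, h⟩
      exact hw (by rwa [← sub_eq_zero.1 h]))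
  have hLP : Continuous fun θ : ℝ => L (circleMap w r θ) - Real.log r :=
    ((hL.comp_continuous (continuous_circleMap w r) hall)).sub continuous_const
  have key : ∀ θ ∈ (univ : Set ℝ), Complex.exp (L (circleMap w r θ) - Real.log r)
      = Complex.exp ((θ : ℝ) * Complex.I) := by
    intro θ _
    have h1 : Complex.exp (L (circleMap w r θ)) = circleMap w r θ - w := hLg (hall θ)
    rw [Complex.exp_sub, h1, circleMap_sub_center, circleMap_zero, ← Complex.ofReal_exp,
      Real.exp_log hr]
    have : (r : ℂ) ≠ 0 := by exact_mod_cast hr.ne'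
    field_simp
  have h := eq_of_exp_eq_exp_mul_I isPreconnected_univ hLP.continuousOn
    (θ := fun θ => θ) continuousOn_id key (mem_univ (0 : ℝ)) (mem_univ (2 * Real.pi))
  have h2 : circleMap w r (2 * Real.pi) = circleMap w r 0 := by
    simpa using (periodic_circleMap w r) 0
  simp only [h2] at h
  linarith [Real.pi_pos]

theorem exists_last_notMem {T : Set ℝ} (hT : IsOpen T) {s t : ℝ} (hst : s ≤ t) (hs : s ∉ T)
    (ht : t ∈ T) : ∃ a, s ≤ a ∧ a < t ∧ a ∉ T ∧ Ioc a t ⊆ T := by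
  obtain ⟨a, ha, hmax⟩ := (isCompact_Icc.diff hT : IsCompact (Icc s t \ T)).exists_isGreatest
    ⟨s, ⟨le_rfl, hst⟩, hs⟩
  refine ⟨a, ha.1.1, lt_of_le_of_ne ha.1.2 (fun h => ha.2 (h ▸ ht)), ha.2, fun x hx => ?_⟩
  by_contra hxT
  exact absurd (hmax ⟨⟨ha.1.1.trans hx.1.le, hx.2⟩, hxT⟩) (not_le.2 hx.1)

theorem exists_first_notMem {T : Set ℝ} (hT : IsOpen T) {s t : ℝ} (hst : t ≤ s) (hs : s ∉ T)
    (ht : t ∈ T) : ∃ b, b ≤ s ∧ t < b ∧ b ∉ T ∧ Ico t b ⊆ T := by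
  obtain ⟨b, hb, hmin⟩ := (isCompact_Icc.diff hT : IsCompact (Icc t s \ T)).exists_isLeast
    ⟨s, ⟨hst, le_rfl⟩, hs⟩
  refine ⟨b, hb.1.2, lt_of_le_of_ne hb.1.1 (fun h => hb.2 (h ▸ ht)), hb.2, fun x hx => ?_⟩
  by_contra hxT
  exact absurd (hmin ⟨⟨hx.1, hx.2.le.trans hb.1.2⟩, hxT⟩) (not_le.2 hx.2)

theorem circleMap_eq_imp {w : ℂ} {r : ℝ} (hr : 0 < r) {s t : ℝ}
    (h : circleMap w r s = circleMap w r t) : ∃ n : ℤ, s = t + n * (2 * Real.pi) := by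
  obtain ⟨n, hn⟩ := (circleMap_eq_circleMap_iff w hr.ne').1 h
  refine ⟨n, ?_⟩
  have := congrArg Complex.im hn
  simpa using this

/-- Description of a gate as an open circular arc. -/
theorem gate_eq_arc {U : Set ℂ} (hU : IsOpen U) (hsc : IsSimplyConnected U)
    {w x : ℂ} (hw : w ∉ U) (hx : x ∈ U) : ∃ a b : ℝ, a < b ∧ b ≤ a + 2 * Real.pi ∧
      circleMap w (dist x w) a ∉ U ∧ circleMap w (dist x w) b ∉ U ∧
      gate U w x = circleMap w (dist x w) '' Ioo a b := by
  set r := dist x w with hr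
  have hr0 : 0 < r := dist_pos.2 fun h => hw (h ▸ hx)
  have hpi := Real.pi_pos
  have hper : ∀ (n : ℤ) θ, circleMap w r (θ + n * (2 * Real.pi)) = circleMap w r θ := by
    intro n θ
    exact_mod_cast (periodic_circleMap w r).int_mul n θ
  have hcont := continuous_circleMap w r
  set T := circleMap w r ⁻¹' U with hT
  have hTo : IsOpen T := hU.preimage hcont
  obtain ⟨t₀, -, ht₀⟩ : ∃ t ∈ Ioc 0 (2 * Real.pi), circleMap w r t = x := by
    have : x ∈ circleMap w r '' Ioc 0 (2 * Real.pi) := by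
      rw [image_circleMap_Ioc, abs_of_pos hr0]; exact hr.symm
    exact this
  have ht₀T : t₀ ∈ T := by rw [hT, mem_preimage, ht₀]; exact hx
  obtain ⟨s, hs⟩ := exists_circleMap_notMem hU hsc hw hr0
  obtain ⟨n, hn, -⟩ := existsUnique_add_zsmul_mem_Ioc (mul_pos two_pos hpi) s (t₀ - 2 * Real.pi)
  set s' := s + n • (2 * Real.pi) with hs'
  have hs'T : s' ∉ T := by
    rw [hT, mem_preimage, hs', zsmul_eq_mul, hper]; exact hs
  have hs'' : s' + 2 * Real.pi ∉ T := by
    rw [hT, mem_preimage, periodic_circleMap w r]; exact hs'T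
  have hst : s' < t₀ := lt_of_le_of_ne (by linarith [hn.2]) (fun h => hs'T (h ▸ ht₀T))
  obtain ⟨a, ha1, ha2, haT, haT'⟩ := exists_last_notMem hTo hst.le hs'T ht₀T
  have haT2 : a + 2 * Real.pi ∉ T := by
    rw [hT, mem_preimage, periodic_circleMap w r]; exact haT
  obtain ⟨b, hb1, hb2, hbT, hbT'⟩ := exists_first_notMem hTo (s := a + 2 * Real.pi)
    (by linarith [hn.1]) haT2 ht₀T
  refine ⟨a, b, ha2.trans hb2, hb1, haT, hbT, ?_⟩
  have hsub : Ioo a b ⊆ T := by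
    intro t ht
    rcases le_total t t₀ with h | h
    · exact haT' ⟨ht.1, h⟩
    · exact hbT' ⟨h, ht.2⟩
  apply Subset.antisymm
  · have hcl1 : IsClosed (circleMap w r '' Icc a b) := (isCompact_Icc.image hcont).isClosed
    have hcl2 : IsClosed (circleMap w r '' Icc b (a + 2 * Real.pi)) :=
      (isCompact_Icc.image hcont).isClosed
    have hcov : gate U w x ⊆ circleMap w r '' Icc a b ∪
        circleMap w r '' Icc b (a + 2 * Real.pi) := by
      intro y hy
      have hys := gate_subset_sphere hy
      have : y ∈ circleMap w r '' Ioc 0 (2 * Real.pi) := by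
        rw [image_circleMap_Ioc, abs_of_pos hr0]; exact hys
      obtain ⟨t, -, rfl⟩ := this
      obtain ⟨m, hm, -⟩ := existsUnique_add_zsmul_mem_Ioc (mul_pos two_pos hpi) t a
      rw [← hper m t]
      rw [zsmul_eq_mul] at hm
      rcases le_total (t + m * (2 * Real.pi)) b with h | h
      · exact Or.inl ⟨_, ⟨hm.1.le, h⟩, rfl⟩
      · exact Or.inr ⟨_, ⟨h, hm.2⟩, rfl⟩
    have hdis : gate U w x ∩ (circleMap w r '' Icc a b ∩
        circleMap w r '' Icc b (a + 2 * Real.pi)) = ∅ := by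
      rw [eq_empty_iff_forall_notMem]
      rintro y ⟨hyg, ⟨p, hp, rfl⟩, ⟨q, hq, hpq⟩⟩
      have hyU : p ∈ T := gate_subset hyg
      have hqU : q ∈ T := by rw [hT, mem_preimage, hpq]; exact gate_subset hyg
      obtain ⟨k, hk⟩ := circleMap_eq_imp hr0 hpq
      have h1 : (0 : ℝ) ≤ k := by
        have : 0 ≤ (k : ℝ) * (2 * Real.pi) := by linarith [hp.2, hq.1]
        exact nonneg_of_mul_nonneg_left this (by positivity)
      have h2 : (k : ℝ) ≤ 1 := by
        have : (k : ℝ) * (2 * Real.pi) ≤ 1 * (2 * Real.pi) := by linarith [hp.1, hq.2]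
        exact le_of_mul_le_mul_right this (by positivity)
      have h1' : 0 ≤ k := by exact_mod_cast h1
      have h2' : k ≤ 1 := by exact_mod_cast h2
      have h3 : k = 0 ∨ k = 1 := by omega
      rcases h3 with rfl | rfl
      · have : p = b := by
          simp at hk; linarith [hp.2, hq.1]
        exact hbT (this ▸ hyU)
      · have : p = a := by
          simp at hk; linarith [hp.1, hq.2]
        exact haT (this ▸ hyU)
    have hx1 : x ∈ circleMap w r '' Icc a b := ⟨t₀, ⟨ha2.le, hb2.le⟩, ht₀⟩
    rcases isPreconnected_iff_subset_of_disjoint_closed.1 (isPreconnected_gate (U := U) (w := w)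
      (x := x)) _ _ hcl1 hcl2 hcov hdis with h | h
    · intro y hy
      obtain ⟨t, ht, rfl⟩ := h hy
      have htT : t ∈ T := gate_subset hy
      exact ⟨t, ⟨lt_of_le_of_ne ht.1 (fun e => haT (e ▸ htT)),
        lt_of_le_of_ne ht.2 (fun e => hbT (e ▸ htT))⟩, rfl⟩
    · exfalso
      have : x ∈ gate U w x ∩ (circleMap w r '' Icc a b ∩
        circleMap w r '' Icc b (a + 2 * Real.pi)) := ⟨mem_gate hx, hx1, h (mem_gate hx)⟩
      rwa [hdis] at this
  · refine (isPreconnected_Ioo.image _ hcont.continuousOn).subset_connectedComponentIn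
      ⟨t₀, ⟨ha2, hb2⟩, ht₀⟩ ?_
    rintro _ ⟨t, ht, rfl⟩
    exact ⟨circleMap_mem_sphere w hr0.le t, hsub ht⟩

theorem circleMap_eq_exp {w : ℂ} {r : ℝ} (hr : 0 < r) (θ : ℝ) :
    circleMap w r θ = w + Complex.exp ((Real.log r : ℝ) + θ * Complex.I) := by
  rw [circleMap, Complex.exp_add, ← Complex.ofReal_exp, Real.exp_log hr]

theorem dist_exp_center (w ζ : ℂ) : dist (w + Complex.exp ζ) w = Real.exp ζ.re := by
  simp [dist_eq_norm, Complex.norm_exp]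

theorem isPreconnected_compl_closedBall (w : ℂ) {r : ℝ} (hr : 0 < r) :
    IsPreconnected (Metric.closedBall w r)ᶜ := by
  have : (Metric.closedBall w r)ᶜ = (fun ζ => w + Complex.exp ζ) '' {ζ : ℂ | Real.log r < ζ.re} := by
    ext y
    simp only [mem_compl_iff, Metric.mem_closedBall, not_le, mem_image, mem_ofPred_eq]
    constructor
    · intro h
      have h0 : y - w ≠ 0 := by
        intro h'
        rw [dist_eq_norm, h', norm_zero] at h; linarith
      refine ⟨Complex.log (y - w), ?_, by rw [Complex.exp_log h0]; ring⟩
      rw [Complex.log_re]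
      exact Real.log_lt_log hr (by rwa [dist_eq_norm] at h)
    · rintro ⟨ζ, hζ, rfl⟩
      rw [dist_exp_center]
      exact (Real.log_lt_iff_lt_exp hr).1 hζ
  rw [this]
  exact (convex_halfSpace_re_gt _).isPreconnected.image _ (by fun_prop)

/-- An open circular arc inside an open set has a connected open collar, cut by the
circle into an inner and an outer connected part. -/
theorem exists_collar {O : Set ℂ} (hO : IsOpen O) {w : ℂ} {r : ℝ} (hr : 0 < r)
    {a b : ℝ} (hab : a < b) (ha : circleMap w r a ∉ O) (harc : circleMap w r '' Ioo a b ⊆ O) :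
    ∃ N N₁ N₂ : Set ℂ, IsOpen N ∧ IsPreconnected N ∧ circleMap w r '' Ioo a b ⊆ N ∧ N ⊆ O ∧
      IsPreconnected N₁ ∧ IsPreconnected N₂ ∧ N₁.Nonempty ∧ N₂.Nonempty ∧ N₁ ⊆ N ∧ N₂ ⊆ N ∧
      (∀ y ∈ N₁, dist y w < r) ∧ (∀ y ∈ N₂, r < dist y w) ∧
      ∀ y ∈ N, dist y w ≠ r → y ∈ N₁ ∪ N₂ := by
  set Φ : ℂ → ℂ := fun ζ => w + Complex.exp ζ with hΦ
  have hΦc : Continuous Φ := by fun_prop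
  have hΦo : IsOpenMap Φ := (Homeomorph.addLeft w).isOpenMap.comp Complex.isOpenMap_exp
  set G := Φ ⁻¹' O with hG
  have hGo : IsOpen G := hO.preimage hΦc
  let S : ℝ → ℂ := fun t => (Real.log r : ℝ) + t * Complex.I
  have hGn : (Gᶜ).Nonempty := ⟨S a, fun h => ha (by rw [circleMap_eq_exp hr]; exact h)⟩
  have hS : Continuous S := by fun_prop
  have hSG : ∀ t ∈ Ioo a b, S t ∈ G := fun t ht => harc ⟨t, ht, circleMap_eq_exp hr t⟩
  let d : ℝ → ℝ := fun t => Metric.infDist (S t) Gᶜ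
  have hd : Continuous d := (Metric.continuous_infDist_pt _).comp hS
  have hdpos : ∀ t ∈ Ioo a b, 0 < d t := by
    intro t ht
    refine (hGo.isClosed_compl.notMem_iff_infDist_pos hGn).1 ?_
    simpa using hSG t ht
  let κ : ℝ × ℝ → ℂ := fun p => Φ (((Real.log r + p.2 * d p.1 : ℝ) : ℂ) + p.1 * Complex.I)
  have hκ : Continuous κ := by
    refine hΦc.comp ?_
    have : Continuous fun p : ℝ × ℝ => Real.log r + p.2 * d p.1 := by fun_prop
    fun_prop
  have hκdist : ∀ p, dist (κ p) w = Real.exp (Real.log r + p.2 * d p.1) := by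
    intro p
    simp only [κ, hΦ, dist_exp_center]
    simp
  have hlt : ∀ x, Real.exp x < r ↔ x < Real.log r := fun x => (Real.lt_log_iff_exp_lt hr).symm
  have hgt : ∀ x, r < Real.exp x ↔ Real.log r < x := fun x => (Real.log_lt_iff_lt_exp hr).symm
  set Ω : Set ℂ := {ζ | a < ζ.im ∧ ζ.im < b ∧ |ζ.re - Real.log r| < d ζ.im} with hΩ
  have hΩo : IsOpen Ω := by
    have h1 : IsOpen {ζ : ℂ | a < ζ.im} := isOpen_lt continuous_const Complex.continuous_im
    have h2 : IsOpen {ζ : ℂ | ζ.im < b} := isOpen_lt Complex.continuous_im continuous_const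
    have h3 : IsOpen {ζ : ℂ | |ζ.re - Real.log r| < d ζ.im} :=
      isOpen_lt (Complex.continuous_re.sub continuous_const).abs (hd.comp Complex.continuous_im)
    exact h1.inter (h2.inter h3)
  have himg : κ '' (Ioo a b ×ˢ Ioo (-1) 1) = Φ '' Ω := by
    ext y
    constructor
    · rintro ⟨⟨t, u⟩, ⟨ht, hu⟩, rfl⟩
      refine ⟨_, ?_, rfl⟩
      have h1 : |u| < 1 := abs_lt.2 hu
      have h2 := hdpos t ht
      simp only [hΩ, mem_ofPred_eq]
      refine ⟨by simpa using ht.1, by simpa using ht.2, ?_⟩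
      simp only [Complex.add_re, Complex.add_im, Complex.ofReal_re, Complex.ofReal_im,
        Complex.mul_re, Complex.mul_im, Complex.I_re, Complex.I_im]
      ring_nf
      rw [abs_mul, abs_of_pos h2]
      nlinarith
    · rintro ⟨ζ, ⟨h1, h2, h3⟩, rfl⟩
      have h4 := hdpos ζ.im ⟨h1, h2⟩
      refine ⟨(ζ.im, (ζ.re - Real.log r) / d ζ.im), ⟨⟨h1, h2⟩, ?_⟩, ?_⟩
      · rw [mem_Ioo, ← abs_lt, abs_div, abs_of_pos h4, div_lt_one h4]
        exact h3
      · simp only [κ]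
        congr 1
        rw [div_mul_cancel₀ _ h4.ne']
        apply Complex.ext <;> simp
  refine ⟨κ '' (Ioo a b ×ˢ Ioo (-1) 1), κ '' (Ioo a b ×ˢ Ioo (-1) 0),
    κ '' (Ioo a b ×ˢ Ioo 0 1), himg ▸ hΦo _ hΩo,
    (isPreconnected_Ioo.prod isPreconnected_Ioo).image _ hκ.continuousOn, ?_, ?_,
    (isPreconnected_Ioo.prod isPreconnected_Ioo).image _ hκ.continuousOn,
    (isPreconnected_Ioo.prod isPreconnected_Ioo).image _ hκ.continuousOn,
    ((nonempty_Ioo.2 hab).prod (nonempty_Ioo.2 (by norm_num))).image _,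
    ((nonempty_Ioo.2 hab).prod (nonempty_Ioo.2 (by norm_num))).image _,
    image_mono (prod_mono_right (Ioo_subset_Ioo_right (by norm_num))),
    image_mono (prod_mono_right (Ioo_subset_Ioo_left (by norm_num))), ?_, ?_, ?_⟩
  · rintro _ ⟨t, ht, rfl⟩
    refine ⟨(t, 0), ⟨ht, by norm_num⟩, ?_⟩
    simp only [κ, circleMap_eq_exp hr, hΦ, zero_mul, add_zero]
  · rw [himg]
    rintro _ ⟨ζ, ⟨h1, h2, h3⟩, rfl⟩
    by_contra hne
    have hζ : ζ ∈ Gᶜ := hne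
    have h4 : d ζ.im ≤ dist (S ζ.im) ζ := Metric.infDist_le_dist_of_mem hζ
    have h5 : dist (S ζ.im) ζ = |ζ.re - Real.log r| := by
      have : S ζ.im - ζ = ((Real.log r - ζ.re : ℝ) : ℂ) := by
        apply Complex.ext <;> simp [S]
      rw [dist_eq_norm, this, Complex.norm_real, Real.norm_eq_abs, abs_sub_comm]
    linarith
  · rintro _ ⟨⟨t, u⟩, ⟨ht, hu⟩, rfl⟩
    rw [hκdist, hlt]
    have := hdpos t ht
    have := hu.2
    simp only at *
    nlinarith
  · rintro _ ⟨⟨t, u⟩, ⟨ht, hu⟩, rfl⟩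
    rw [hκdist, hgt]
    have := hdpos t ht
    have := hu.1
    simp only at *
    nlinarith
  · rintro _ ⟨⟨t, u⟩, ⟨ht, hu⟩, rfl⟩ hne
    rcases lt_trichotomy u 0 with h | h | h
    · exact Or.inl ⟨(t, u), ⟨ht, hu.1, h⟩, rfl⟩
    · exfalso
      apply hne
      rw [hκdist]
      simp [h, Real.exp_log hr]
    · exact Or.inr ⟨(t, u), ⟨ht, h, hu.2⟩, rfl⟩

theorem isOpen_diff_gate {U : Set ℂ} (hU : IsOpen U) (hsc : IsSimplyConnected U) {w x : ℂ}
    (hw : w ∉ U) (hx : x ∈ U) : IsOpen (U \ gate U w x) := by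
  obtain ⟨a, b, hab, -, ha, hb, hg⟩ := gate_eq_arc hU hsc hw hx
  have : U \ gate U w x = U \ circleMap w (dist x w) '' Icc a b := by
    rw [hg]
    ext y
    constructor
    · rintro ⟨hy, hyc⟩
      refine ⟨hy, ?_⟩
      rintro ⟨t, ht, rfl⟩
      exact hyc ⟨t, ⟨lt_of_le_of_ne ht.1 (fun e => ha (e ▸ hy)),
        lt_of_le_of_ne ht.2 (fun e => hb (e ▸ hy))⟩, rfl⟩
    · rintro ⟨hy, hyc⟩
      exact ⟨hy, fun h => hyc (image_mono Ioo_subset_Icc_self h)⟩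
  rw [this]
  exact hU.sdiff (isCompact_Icc.image (continuous_circleMap _ _)).isClosed

theorem isCrossCut_gate {U : Set ℂ} (hU : IsOpen U) (hsc : IsSimplyConnected U)
    (hbdd : Bornology.IsBounded U) {w x : ℂ} (hw : w ∉ U) (hx : x ∈ U) :
    IsCrossCut U (gate U w x) := by
  have hUc : IsPreconnected U := hsc.isPathConnected.isConnected.isPreconnected
  have hco : IsOpen (U \ gate U w x) := isOpen_diff_gate hU hsc hw hx
  obtain ⟨a, b, hab, hba, ha, hb, hg⟩ := gate_eq_arc hU hsc hw hx
  set r := dist x w with hr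
  have hr0 : 0 < r := dist_pos.2 fun h => hw (h ▸ hx)
  set c := gate U w x with hc
  set P := circleMap w r with hP
  have hPc : Continuous P := continuous_circleMap w r
  have hpi := Real.pi_pos
  have hcU : c ⊆ U := gate_subset
  -- the collar
  set O := U \ P '' Icc b (a + 2 * Real.pi) with hO
  have hOo : IsOpen O := hU.sdiff (isCompact_Icc.image hPc).isClosed
  have hcO : P '' Ioo a b ⊆ O := by
    rintro _ ⟨t, ht, rfl⟩
    refine ⟨hcU (hg ▸ ⟨t, ht, rfl⟩), ?_⟩
    rintro ⟨s, hs, hst⟩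
    obtain ⟨k, hk⟩ := circleMap_eq_imp hr0 hst
    have h1 : (0 : ℝ) < k := by
      have : 0 < (k : ℝ) * (2 * Real.pi) := by linarith [ht.2, hs.1]
      exact pos_of_mul_pos_left this (by positivity)
    have h2 : (k : ℝ) < 1 := by
      have : (k : ℝ) * (2 * Real.pi) < 1 * (2 * Real.pi) := by linarith [ht.1, hs.2]
      exact lt_of_mul_lt_mul_right this (by positivity)
    have h1' : 0 < k := by exact_mod_cast h1
    have h2' : k < 1 := by exact_mod_cast h2
    omega
  obtain ⟨N, N₁, N₂, hNo, hNp, hcN, hNO, hN₁, hN₂, hN₁n, hN₂n, hN₁N, hN₂N, hN₁r, hN₂r, hNr⟩ :=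
    exists_collar hOo hr0 hab (fun h => ha h.1) hcO
  have hNU : N ⊆ U := fun y hy => (hNO hy).1
  rw [← hg] at hcN
  have hcr : ∀ y ∈ c, dist y w = r := fun y hy => gate_subset_sphere hy
  have hN₁c : N₁ ⊆ U \ c := fun y hy =>
    ⟨hNU (hN₁N hy), fun h => by linarith [hcr y h, hN₁r y hy]⟩
  have hN₂c : N₂ ⊆ U \ c := fun y hy =>
    ⟨hNU (hN₂N hy), fun h => by linarith [hcr y h, hN₂r y hy]⟩
  have hNc : N \ c ⊆ N₁ ∪ N₂ := by
    rintro y ⟨hyN, hyc⟩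
    refine hNr y hyN fun hyr => hyc ?_
    have : y ∈ P '' Ioc 0 (2 * Real.pi) := by
      rw [hP, image_circleMap_Ioc, abs_of_pos hr0]; exact hyr
    obtain ⟨t, -, rfl⟩ := this
    obtain ⟨m, hm, -⟩ := existsUnique_add_zsmul_mem_Ioc (mul_pos two_pos hpi) t a
    have hPt : P (t + m • (2 * Real.pi)) = P t := by
      rw [zsmul_eq_mul]
      exact_mod_cast (periodic_circleMap w r).int_mul m t
    rw [hg]
    refine ⟨t + m • (2 * Real.pi), ⟨hm.1, ?_⟩, hPt⟩
    by_contra! hle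
    exact (hNO hyN).2 ⟨_, ⟨hle, hm.2⟩, hPt⟩
  obtain ⟨n₁, hn₁⟩ := hN₁n
  obtain ⟨n₂, hn₂⟩ := hN₂n
  -- every component contains one of the two sides of the collar
  have hcomp : ∀ y ∈ U \ c, N₁ ⊆ connectedComponentIn (U \ c) y ∨
      N₂ ⊆ connectedComponentIn (U \ c) y := by
    intro y hy
    obtain ⟨p, hpU, hpf⟩ := hUc.exists_mem_frontier (V := connectedComponentIn (U \ c) y)
      ⟨y, hy.1, mem_connectedComponentIn hy⟩
      ⟨x, hx, fun h => (connectedComponentIn_subset _ _ h).2 (mem_gate hx)⟩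
    have hpc : p ∈ c := by
      by_contra h
      exact notMem_of_mem_frontier_connectedComponentIn hco hpf ⟨hpU, h⟩
    obtain ⟨q, hqN, hq⟩ := mem_closure_iff.1 hpf.1 N hNo (hcN hpc)
    rcases hNc ⟨hqN, (connectedComponentIn_subset _ _ hq).2⟩ with h | h
    · exact Or.inl (subset_connectedComponentIn_of_mem hN₁ hN₁c h hq)
    · exact Or.inr (subset_connectedComponentIn_of_mem hN₂ hN₂c h hq)
  have hne : connectedComponentIn (U \ c) n₁ ≠ connectedComponentIn (U \ c) n₂ := by
    intro heq
    have hall : connectedComponentIn (U \ c) n₁ = U \ c := by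
      refine Subset.antisymm (connectedComponentIn_subset _ _) fun y hy => ?_
      rcases hcomp y hy with h | h
      · rw [← connectedComponentIn_eq (h hn₁)]
        exact mem_connectedComponentIn hy
      · rw [heq, ← connectedComponentIn_eq (h hn₂)]
        exact mem_connectedComponentIn hy
    have hpre : IsPreconnected (U \ c) := hall ▸ isPreconnected_connectedComponentIn
    have hI := IsPreconnected.inter_of_isOpen hU hsc hNp hpre (by
      ext y
      constructor
      · rintro (h | h)
        exacts [hNU h, h.1]
      · intro h
        by_cases hyc : y ∈ c
        · exact Or.inl (hcN hyc)
        · exact Or.inr ⟨h, hyc⟩) hNo hco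
    obtain ⟨q, hq, hq1, hq2⟩ := hI (Metric.ball w r) (Metric.closedBall w r)ᶜ Metric.isOpen_ball
      Metric.isClosed_closedBall.isOpen_compl (by
        rintro y ⟨hyN, hy⟩
        rcases hNc ⟨hyN, hy.2⟩ with h | h
        · exact Or.inl (hN₁r y h)
        · refine Or.inr ?_
          simpa using hN₂r y h)
      ⟨n₁, ⟨hN₁N hn₁, hN₁c hn₁⟩, hN₁r _ hn₁⟩
      ⟨n₂, ⟨hN₂N hn₂, hN₂c hn₂⟩, by simpa using hN₂r _ hn₂⟩
    exact hq2 (Metric.ball_subset_closedBall hq1)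
  have htwo : HasTwoComps (U \ c) (connectedComponentIn (U \ c) n₁)
      (connectedComponentIn (U \ c) n₂) := by
    refine ⟨⟨n₁, hN₁c hn₁, rfl⟩, ⟨n₂, hN₂c hn₂, rfl⟩, hne, fun y hy => ?_⟩
    rcases hcomp y hy with h | h
    · exact Or.inl (connectedComponentIn_eq (h hn₁))
    · exact Or.inr (connectedComponentIn_eq (h hn₂))
  have hfr : ∀ n, n ∈ U \ c → dist n w ≠ r →
      (frontier (connectedComponentIn (U \ c) n) ∩ (frontier U \ P '' Icc a b)).Nonempty := by
    intro n hn hnr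
    by_contra hemp
    rw [not_nonempty_iff_eq_empty] at hemp
    set D := connectedComponentIn (U \ c) n with hD
    have hDU : D ⊆ U \ c := connectedComponentIn_subset _ _
    have hfD : frontier D ⊆ Metric.sphere w r := by
      intro p hp
      by_cases hpU : p ∈ U
      · have hpc : p ∈ c := by
          by_contra h
          exact notMem_of_mem_frontier_connectedComponentIn hco hp ⟨hpU, h⟩
        exact hcr p hpc
      · by_contra hps
        have hpF : p ∈ frontier U := by
          rw [hU.frontier_eq]
          exact ⟨closure_mono (fun y hy => (hDU hy).1) hp.1, hpU⟩
        have : p ∈ frontier D ∩ (frontier U \ P '' Icc a b) := by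
          refine ⟨hp, hpF, ?_⟩
          rintro ⟨t, -, rfl⟩
          exact hps (circleMap_mem_sphere w hr0.le t)
        rwa [hemp] at this
    have hnD : n ∈ D := mem_connectedComponentIn hn
    rcases lt_or_gt_of_ne hnr with h | h
    · have := (convex_ball w r).isPreconnected.subset_of_disjoint_frontier (V := D)
        ⟨n, h, hnD⟩ (by
          rw [eq_empty_iff_forall_notMem]
          rintro p ⟨hp, hpf⟩
          exact (Metric.mem_ball.1 hp).ne (hfD hpf))
      exact hw (hDU (this (Metric.mem_ball_self hr0))).1
    · have := (isPreconnected_compl_closedBall w hr0).subset_of_disjoint_frontier (V := D)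
        ⟨n, by simpa using h, hnD⟩ (by
          rw [eq_empty_iff_forall_notMem]
          rintro p ⟨hp, hpf⟩
          exact hp (Metric.sphere_subset_closedBall (hfD hpf)))
      have hb1 : Bornology.IsBounded (Metric.closedBall w r)ᶜ :=
        hbdd.subset (this.trans (hDU.trans sdiff_subset))
      have hb2 := hb1.union (Metric.isBounded_closedBall (x := w) (r := r))
      rw [compl_union_self] at hb2
      exact NormedSpace.unbounded_univ ℝ ℂ hb2
  have hba' : 0 < b - a := sub_pos.2 hab
  have himg : ∀ I J : Set ℝ, (∀ t, t ∈ I ↔ a + t * (b - a) ∈ J) →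
      (fun t => P (a + t * (b - a))) '' I = P '' J := by
    intro I J hIJ
    ext y
    constructor
    · rintro ⟨t, ht, rfl⟩
      exact ⟨_, (hIJ t).1 ht, rfl⟩
    · rintro ⟨s, hs, rfl⟩
      have : a + (s - a) / (b - a) * (b - a) = s := by
        rw [div_mul_cancel₀ _ hba'.ne']; ring
      exact ⟨(s - a) / (b - a), (hIJ _).2 (by rwa [this]), by simp only [this]⟩
  have hIoo : (fun t => P (a + t * (b - a))) '' Ioo 0 1 = P '' Ioo a b := by
    refine himg _ _ fun t => ?_
    constructor
    · rintro ⟨h1, h2⟩; constructor <;> nlinarith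
    · rintro ⟨h1, h2⟩
      constructor
      · by_contra! h; nlinarith
      · by_contra! h; nlinarith
  have hIcc : (fun t => P (a + t * (b - a))) '' Icc 0 1 = P '' Icc a b := by
    refine himg _ _ fun t => ?_
    constructor
    · rintro ⟨h1, h2⟩; constructor <;> nlinarith
    · rintro ⟨h1, h2⟩
      constructor
      · by_contra! h; nlinarith
      · by_contra! h; nlinarith
  have hPU : ∀ t ∈ Ioo a b, P t ∈ U := fun t ht => hcU (hg ▸ ⟨t, ht, rfl⟩)
  have hcl : P '' Icc a b ⊆ closure U := by
    rw [← closure_Ioo hab.ne]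
    refine (image_closure_subset_closure_image hPc).trans (closure_mono ?_)
    rintro _ ⟨t, ht, rfl⟩
    exact hPU t ht
  refine ⟨fun t => P (a + t * (b - a)), by fun_prop, ?_, ?_, ?_, ?_, by rw [hIoo, hg], _, _, htwo,
    ?_, ?_⟩
  · intro s hs t ht hst
    have h := eq_of_circleMap_eq hr0.ne' (c := w) (a := a + s * (b - a)) (b := a + t * (b - a)) (by
      have h1 : a + s * (b - a) - (a + t * (b - a)) = (s - t) * (b - a) := by ring
      rw [h1, abs_mul, abs_of_pos hba']
      have : |s - t| < 1 := by rw [abs_lt]; constructor <;> linarith [hs.1, hs.2, ht.1, ht.2]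
      nlinarith) hst
    have : s * (b - a) = t * (b - a) := by linarith
    exact mul_right_cancel₀ hba'.ne' this
  · intro t ht
    have : P (a + t * (b - a)) ∈ P '' Ioo a b := hIoo ▸ ⟨t, ht, rfl⟩
    rw [← hg] at this
    exact hcU this
  · rw [hU.frontier_eq]
    simp only [zero_mul, add_zero]
    exact ⟨hcl ⟨a, ⟨le_rfl, hab.le⟩, rfl⟩, ha⟩
  · rw [hU.frontier_eq]
    have : a + 1 * (b - a) = b := by ring
    simp only [this]
    exact ⟨hcl ⟨b, ⟨hab.le, le_rfl⟩, rfl⟩, hb⟩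
  · rw [hIcc]; exact hfr n₁ (hN₁c hn₁) (hN₁r _ hn₁).ne
  · rw [hIcc]; exact hfr n₂ (hN₂c hn₂) (hN₂r _ hn₂).ne'

theorem notMem_sideOf_of_separated {U c e : Set ℂ} {z q y : ℂ} (hc : IsPreconnected c)
    (hcU : c ⊆ U) (hce : Disjoint c e) (hq : q ∈ c) (hqe : q ∉ sideOf U e z) (hz : z ∈ U \ e)
    (hy : y ∉ sideOf U c z) : y ∉ sideOf U e z := by
  have hcUe : c ⊆ U \ e := fun p hp => ⟨hcU hp, disjoint_left.1 hce hp⟩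
  have hdis : ∀ p ∈ sideOf U e z, p ∉ c := fun p hp hpc =>
    hqe (subset_connectedComponentIn_of_mem hc hcUe hpc hp hq)
  have : sideOf U e z ⊆ sideOf U c z :=
    isPreconnected_connectedComponentIn.subset_connectedComponentIn (mem_connectedComponentIn hz)
      fun p hp => ⟨(connectedComponentIn_subset _ _ hp).1, hdis p hp⟩
  exact fun h => hy (this h)

/-- `x` is the end of a polygonal path in `U` of length `L` starting at `z`. -/
inductive Reach (U : Set ℂ) (z : ℂ) : ℂ → ℝ → Prop
  | base : Reach U z z 0
  | step {x x' : ℂ} {L : ℝ} : Reach U z x L → segment ℝ x x' ⊆ U → Reach U z x' (L + dist x x')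

theorem Reach.nonneg {U : Set ℂ} {z x : ℂ} {L : ℝ} (h : Reach U z x L) : 0 ≤ L := by
  induction h with
  | base => exact le_rfl
  | step _ _ ih => exact add_nonneg ih dist_nonneg

theorem exists_reach {U : Set ℂ} (hU : IsOpen U) (hUc : IsPreconnected U) {z : ℂ} (hz : z ∈ U)
    {x : ℂ} (hx : x ∈ U) : ∃ L, Reach U z x L := by
  refine hUc.subset_of_disjoint_frontier (V := {x | ∃ L, Reach U z x L}) ⟨z, hz, 0, Reach.base⟩ ?_ hx
  rw [eq_empty_iff_forall_notMem]
  rintro p ⟨hpU, hp⟩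
  obtain ⟨ε, hε, hball⟩ := Metric.isOpen_iff.1 hU p hpU
  obtain ⟨q, hq, L, hL⟩ := mem_closure_iff.1 hp.1 _ Metric.isOpen_ball (Metric.mem_ball_self hε)
  have hsub : Metric.ball p ε ⊆ {x | ∃ L, Reach U z x L} := fun y hy =>
    ⟨L + dist q y, hL.step (((convex_ball p ε).segment_subset hq hy).trans hball)⟩
  exact hp.2 (interior_maximal hsub Metric.isOpen_ball (Metric.mem_ball_self hε))

/-- A path leaving the side of `z` first crosses the barrier. -/
theorem Reach.exists_crossing {U c : Set ℂ} {z q : ℂ} {L : ℝ} (h : Reach U z q L) (hz : z ∈ U \ c)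
    (hq : q ∉ sideOf U c z) : ∃ q' ∈ c, ∃ L', Reach U z q' L' ∧ L' + dist q' q ≤ L := by
  induction h with
  | base => exact absurd (mem_connectedComponentIn hz) hq
  | @step x xx L h hs ih =>
    by_cases hx : x ∈ sideOf U c z
    · obtain ⟨q', hq's, hq'c⟩ : ∃ q' ∈ segment ℝ x xx, q' ∈ c := by
        by_contra! hne
        exact hq (subset_connectedComponentIn_of_mem (W := U \ c) (convex_segment x xx).isPreconnected
          (fun p hp => ⟨hs hp, hne p hp⟩) (left_mem_segment ℝ x xx) hx (right_mem_segment ℝ x xx))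
      refine ⟨q', hq'c, L + dist x q', h.step ?_, ?_⟩
      · exact ((convex_segment x xx).segment_subset (left_mem_segment ℝ x xx) hq's).trans hs
      · rw [add_assoc, dist_add_dist_of_mem_segment hq's]
    · obtain ⟨q', hq', L', hL', hle⟩ := ih hx
      exact ⟨q', hq', L', hL', by linarith [dist_triangle q' x xx]⟩

/-- Gates are relatively open in their circle. -/
theorem exists_isOpen_gate {U : Set ℂ} (hU : IsOpen U) (hsc : IsSimplyConnected U)
    {w x : ℂ} (hw : w ∉ U) (hx : x ∈ U) :
    ∃ O : Set ℂ, IsOpen O ∧ O ∩ Metric.sphere w (dist x w) = gate U w x := by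
  obtain ⟨a, b, hab, hba, ha, hb, hg⟩ := gate_eq_arc hU hsc hw hx
  have hr0 : 0 < dist x w := dist_pos.2 fun h => hw (h ▸ hx)
  have hpi := Real.pi_pos
  refine ⟨(circleMap w (dist x w) '' Icc b (a + 2 * Real.pi))ᶜ,
    (isCompact_Icc.image (continuous_circleMap _ _)).isClosed.isOpen_compl, ?_⟩
  rw [hg]
  ext y
  constructor
  · rintro ⟨hyO, hys⟩
    have : y ∈ circleMap w (dist x w) '' Ioc 0 (2 * Real.pi) := by
      rw [image_circleMap_Ioc, abs_of_pos hr0]; exact hys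
    obtain ⟨t, -, rfl⟩ := this
    obtain ⟨m, hm, -⟩ := existsUnique_add_zsmul_mem_Ioc (mul_pos two_pos hpi) t a
    have hPt : circleMap w (dist x w) (t + m • (2 * Real.pi)) = circleMap w (dist x w) t := by
      rw [zsmul_eq_mul]
      exact_mod_cast (periodic_circleMap w (dist x w)).int_mul m t
    refine ⟨t + m • (2 * Real.pi), ⟨hm.1, ?_⟩, hPt⟩
    by_contra! hle
    exact hyO ⟨_, ⟨hle, hm.2⟩, hPt⟩
  · rintro ⟨t, ht, rfl⟩
    refine ⟨?_, circleMap_mem_sphere w hr0.le t⟩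
    rintro ⟨s, hs, hst⟩
    obtain ⟨k, hk⟩ := circleMap_eq_imp hr0 hst
    have h1 : (0 : ℝ) < k := by
      have : 0 < (k : ℝ) * (2 * Real.pi) := by linarith [ht.2, hs.1]
      exact pos_of_mul_pos_left this (by positivity)
    have h2 : (k : ℝ) < 1 := by
      have : (k : ℝ) * (2 * Real.pi) < 1 * (2 * Real.pi) := by linarith [ht.1, hs.2]
      exact lt_of_mul_lt_mul_right this (by positivity)
    have h1' : 0 < k := by exact_mod_cast h1
    have h2' : k < 1 := by exact_mod_cast h2
    omega

theorem gate_eq_of_mem {U : Set ℂ} {w x y : ℂ} (hy : y ∈ gate U w x) : gate U w x = gate U w y := by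
  have h : dist y w = dist x w := gate_subset_sphere hy
  rw [gate, gate, h]
  exact connectedComponentIn_eq hy

theorem exists_tendsto_of_mem_isCompact {ι : Type*} (𝓤 : Ultrafilter ι) {K : Set X} (hK : IsCompact K)
    {u : ι → X} (hu : ∀ᶠ i in (𝓤 : Filter ι), u i ∈ K) : ∃ p ∈ K, Tendsto u 𝓤 (𝓝 p) := by
  obtain ⟨p, hp, h⟩ := hK.ultrafilter_le_nhds (𝓤.map u) (le_principal_iff.2 hu)
  exact ⟨p, hp, h⟩

theorem eq_or_eq_of_equidistant {o p p' m : ℂ} (hpp : p ≠ p') (ho : dist p o = dist p' o)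
    (hm : dist m p = dist m p') :
    m = o + dist m o * ‖p - p'‖ * Complex.I / (starRingEnd ℂ) (p - p') ∨
      m = o - dist m o * ‖p - p'‖ * Complex.I / (starRingEnd ℂ) (p - p') := by
  have hu : (starRingEnd ℂ) (p - p') ≠ 0 := by
    rw [Ne, map_eq_zero]; exact sub_ne_zero.2 hpp
  set v := (m - o) * (starRingEnd ℂ) (p - p') with hv
  have hre : v.re = 0 := by
    have h1 : Complex.normSq (p - o) = Complex.normSq (p' - o) := by
      rw [Complex.normSq_eq_norm_sq, Complex.normSq_eq_norm_sq, ← dist_eq_norm, ← dist_eq_norm, ho]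
    have h2 : Complex.normSq (m - p) = Complex.normSq (m - p') := by
      rw [Complex.normSq_eq_norm_sq, Complex.normSq_eq_norm_sq, ← dist_eq_norm, ← dist_eq_norm, hm]
    simp only [Complex.normSq_apply, Complex.sub_re, Complex.sub_im] at h1 h2
    simp only [hv, Complex.mul_re, Complex.sub_re, Complex.sub_im, Complex.conj_re, Complex.conj_im]
    linarith
  have hv' : v = v.im * Complex.I := by
    apply Complex.ext <;> simp [hre]
  have hn : |v.im| = dist m o * ‖p - p'‖ := by
    have : ‖v‖ = |v.im| := by
      rw [hv']; simp
    rw [← this, hv, norm_mul, Complex.norm_conj, dist_eq_norm]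
  have hm' : m = o + v / (starRingEnd ℂ) (p - p') := by
    rw [hv, mul_div_cancel_right₀ _ hu]; ring
  rcases abs_eq (by positivity) |>.1 hn with h | h
  · left
    rw [hv', h] at hm'
    conv_lhs => rw [hm']
    push_cast
    ring
  · right
    rw [hv', h] at hm'
    conv_lhs => rw [hm']
    push_cast
    ring

/-- Pairwise different gates on one circle shrink to a boundary point. -/
theorem exists_gates_subset_closedBall {U : Set ℂ} (hU : IsOpen U) (hsc : IsSimplyConnected U)
    (hbdd : Bornology.IsBounded U) {o : ℂ} (ho : o ∉ U) {r : ℝ} (𝓤 : Ultrafilter ℕ) {x : ℕ → ℂ}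
    (hx : ∀ᶠ i in (𝓤 : Filter ℕ), x i ∈ U ∧ dist (x i) o = r)
    (hne : ∀ e : Set ℂ, ∀ᶠ i in (𝓤 : Filter ℕ), gate U o (x i) ≠ e) {ℓ : ℝ} :
    0 < ℓ → ∃ p ∈ frontier U, ∀ᶠ i in (𝓤 : Filter ℕ), gate U o (x i) ⊆ Metric.closedBall p ℓ := by
  intro hℓ
  have hK : IsCompact (closure U) := hbdd.isCompact_closure
  obtain ⟨p, hp, hxp⟩ := exists_tendsto_of_mem_isCompact 𝓤 hK
    (hx.mono fun i hi => subset_closure hi.1)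
  have hpo : dist p o = r := tendsto_nhds_unique (hxp.dist tendsto_const_nhds)
    (tendsto_const_nhds.congr' (hx.mono fun i hi => hi.2.symm))
  have hpU : p ∉ U := by
    intro hpU
    obtain ⟨O, hO, hOg⟩ := exists_isOpen_gate hU hsc ho hpU
    have hpO : p ∈ O := by
      have : p ∈ O ∩ Metric.sphere o (dist p o) := hOg ▸ mem_gate hpU
      exact this.1
    obtain ⟨i, hi1, hi2, hi3⟩ :=
      ((hne (gate U o p)).and ((hxp.eventually (hO.mem_nhds hpO)).and hx)).exists
    have : x i ∈ gate U o p := hOg ▸ ⟨hi2, by rw [Metric.mem_sphere, hi3.2, hpo]⟩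
    exact hi1 (gate_eq_of_mem this).symm
  refine ⟨p, by rw [hU.frontier_eq]; exact ⟨hp, hpU⟩, ?_⟩
  by_contra hcon
  rw [← Ultrafilter.eventually_not] at hcon
  have : ∀ i, ∃ x'' : ℂ, ¬ gate U o (x i) ⊆ Metric.closedBall p ℓ →
      x'' ∈ gate U o (x i) ∧ ℓ < dist x'' p := by
    intro i
    by_cases h : gate U o (x i) ⊆ Metric.closedBall p ℓ
    · exact ⟨0, fun h' => absurd h h'⟩
    · obtain ⟨q, hq, hq'⟩ := not_subset.1 h
      exact ⟨q, fun _ => ⟨hq, by simpa using hq'⟩⟩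
  choose x'' hx'' using this
  have hx2 : ∀ᶠ i in (𝓤 : Filter ℕ), x'' i ∈ gate U o (x i) ∧ ℓ < dist (x'' i) p :=
    hcon.mono fun i hi => hx'' i hi
  obtain ⟨p', hp', hxp'⟩ := exists_tendsto_of_mem_isCompact 𝓤 hK
    (hx2.mono fun i hi => subset_closure (gate_subset hi.1))
  have hpp' : p ≠ p' := by
    rintro rfl
    obtain ⟨i, hi1, hi2⟩ := (hx2.and (hxp'.eventually (Metric.ball_mem_nhds p hℓ))).exists
    exact absurd hi1.2 (not_lt.2 (Metric.mem_ball.1 hi2).le)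
  have hp'o : dist p' o = r := tendsto_nhds_unique (hxp'.dist tendsto_const_nhds)
    (tendsto_const_nhds.congr' ((hx2.and hx).mono fun i hi => by
      rw [← hi.2.2]; exact (gate_subset_sphere hi.1.1).symm))
  have hd : 0 < dist p p' := dist_pos.2 hpp'
  have hm : ∀ᶠ i in (𝓤 : Filter ℕ), ∃ m ∈ gate U o (x i), dist m p = dist m p' := by
    have e1 := hxp.eventually (Metric.ball_mem_nhds p (half_pos hd))
    have e2 := hxp'.eventually (Metric.ball_mem_nhds p' (half_pos hd))
    filter_upwards [hx, hx2, e1, e2] with i h1 h2 h3 h4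
    have hc : ContinuousOn (fun y => dist y p - dist y p') (gate U o (x i)) := by fun_prop
    have := isPreconnected_gate.intermediate_value (mem_gate h1.1) h2.1 hc
    obtain ⟨m, hm, hm'⟩ := this (show (0 : ℝ) ∈ Icc _ _ from
      ⟨by linarith [dist_triangle_left p p' (x i)],
        by linarith [dist_triangle_left p p' (x'' i)]⟩)
    exact ⟨m, hm, sub_eq_zero.1 hm'⟩
  have key : ∀ m : ℂ, ¬ ∀ᶠ i in (𝓤 : Filter ℕ), m ∈ gate U o (x i) := by
    intro m h
    obtain ⟨i, h1, h2⟩ := (h.and (hne (gate U o m))).exists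
    exact h2 (gate_eq_of_mem h1)
  have hm2 : ∀ᶠ i in (𝓤 : Filter ℕ),
      o + r * ‖p - p'‖ * Complex.I / (starRingEnd ℂ) (p - p') ∈ gate U o (x i) ∨
      o - r * ‖p - p'‖ * Complex.I / (starRingEnd ℂ) (p - p') ∈ gate U o (x i) := by
    filter_upwards [hm, hx] with i ⟨m, hmg, hme⟩ h1
    have hmr : dist m o = r := by rw [← h1.2]; exact gate_subset_sphere hmg
    have := eq_or_eq_of_equidistant hpp' (hpo.trans hp'o.symm) hme
    rw [hmr] at this
    rcases this with h | h
    · exact Or.inl (h ▸ hmg)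
    · exact Or.inr (h ▸ hmg)
  rcases Ultrafilter.eventually_or.1 hm2 with h | h
  · exact key _ h
  · exact key _ h

theorem HasTwoComps.isCompOf_diff {A D₁ D₂ : Set X} (h : HasTwoComps A D₁ D₂) {z : X} (hz : z ∈ A) :
    IsCompOf A (A \ connectedComponentIn A z) := by
  obtain ⟨h1, h2, hne, h12⟩ := h
  wlog hzD : connectedComponentIn A z = D₁ generalizing D₁ D₂
  · exact this h2 h1 hne.symm (fun x hx => (h12 x hx).symm) ((h12 z hz).resolve_left hzD)
  obtain ⟨x, hx, hxD⟩ := h2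
  refine ⟨x, hx, ?_⟩
  ext p
  constructor
  · rintro ⟨hpA, hp⟩
    rcases h12 p hpA with h | h
    · exact absurd (mem_connectedComponentIn hpA) (by rwa [h, ← hzD])
    · rw [← hxD, ← h]; exact mem_connectedComponentIn hpA
  · intro hp
    refine ⟨connectedComponentIn_subset _ _ hp, fun hpz => hne ?_⟩
    rw [← hzD, hxD, connectedComponentIn_eq hp, connectedComponentIn_eq hpz]

/-- The part of `U` which `c` cuts off from `z`. -/
def farSide (U c : Set ℂ) (z : ℂ) : Set ℂ := (U \ c) \ sideOf U c z

theorem isCompOf_farSide {U c : Set ℂ} (hc : IsCrossCut U c) {z : ℂ} (hz : z ∈ U \ c) :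
    IsCompOf (U \ c) (farSide U c z) := by
  obtain ⟨-, -, -, -, -, -, -, D₁, D₂, h, -⟩ := hc
  exact h.isCompOf_diff hz

theorem sideOf_subset {U c : Set ℂ} {z : ℂ} : sideOf U c z ⊆ U \ c := connectedComponentIn_subset _ _

theorem farSide_subset {U c : Set ℂ} {z : ℂ} : farSide U c z ⊆ U \ c := sdiff_subset

theorem diff_sideOf_eq {U c : Set ℂ} {z : ℂ} (hcU : c ⊆ U) : U \ sideOf U c z = c ∪ farSide U c z := by
  have := @sideOf_subset U c z
  ext p
  have h1 := @this p
  have h2 := @hcU p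
  simp only [farSide, Set.mem_sdiff, mem_union] at h1 h2 ⊢
  tauto

theorem isCrossSection_farSide {U c : Set ℂ} (hc : IsCrossCut U c) {z : ℂ} (hz : z ∈ U \ c) :
    IsCrossSection U (farSide U c z) := ⟨c, hc, isCompOf_farSide hc hz⟩

/-- Points of `U` near a boundary point are cut off from `z` by a small gate. -/
theorem exists_gate_eventually_separating {U : Set ℂ} (hU : IsOpen U) (hsc : IsSimplyConnected U)
    (hbdd : Bornology.IsBounded U) (𝓤 : Ultrafilter ℕ) {y : ℕ → ℂ} (hy : ∀ i, y i ∈ U) {b : ℂ}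
    (hb : b ∈ frontier U) (hyb : Tendsto y 𝓤 (𝓝 b)) {z : ℂ} (hz : z ∈ U) {ε : ℝ} (hε : 0 < ε) :
    ∃ w ∈ frontier U, ∃ x ∈ U, dist x w < ε ∧ dist x w < dist z w ∧
      ∀ᶠ i in (𝓤 : Filter ℕ), y i ∉ sideOf U (gate U w x) z := by
  have hUc : IsPreconnected U := hsc.isPathConnected.isConnected.isPreconnected
  have hfr : ∀ w ∈ frontier U, w ∉ U := fun w hw => by rw [hU.frontier_eq] at hw; exact hw.2
  set d₀ := Metric.infDist z Uᶜ with hd₀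
  have hd₀pos : 0 < d₀ := by
    rw [hd₀, ← hU.isClosed_compl.notMem_iff_infDist_pos ⟨b, hfr b hb⟩]
    exact fun h => h hz
  have hd : ∀ w ∈ frontier U, d₀ ≤ dist z w := fun w hw => Metric.infDist_le_dist_of_mem (hfr w hw)
  obtain ⟨r, hr0, hrε, hrd⟩ : ∃ r, 0 < r ∧ r < ε ∧ r < d₀ := by
    obtain ⟨r, h0, h⟩ := exists_between (lt_min hε hd₀pos)
    exact ⟨r, h0, lt_min_iff.1 h⟩
  set ℓ := r / 8 with hℓ
  set G : ℕ → Set ℝ := fun i => {L | ∃ (c : Set ℂ) (q p : ℂ), IsPreconnected c ∧ c ⊆ U ∧ q ∈ c ∧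
    p ∈ frontier U ∧ c ⊆ Metric.closedBall p ℓ ∧ y i ∉ sideOf U c z ∧ Reach U z q L} with hG
  have hGbdd : ∀ i, BddBelow (G i) := fun i => ⟨0, by
    rintro L ⟨c, q, p, -, -, -, -, -, -, hL⟩; exact hL.nonneg⟩
  have hGne : ∀ᶠ i in (𝓤 : Filter ℕ), (G i).Nonempty := by
    filter_upwards [hyb.eventually (Metric.ball_mem_nhds b (show 0 < ℓ by positivity))] with i hi
    obtain ⟨x, hxU, hxb, hx⟩ := exists_gate_separating hU hsc (hy i) hz (Metric.mem_ball.1 hi)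
      (show ℓ < dist z b by linarith [hd b hb])
    obtain ⟨L, hL⟩ := exists_reach hU hUc hz hxU
    refine ⟨L, gate U b x, x, b, isPreconnected_gate, gate_subset, mem_gate hxU, hb, ?_, hx, hL⟩
    exact gate_subset_sphere.trans (hxb ▸ Metric.sphere_subset_closedBall)
  have : ∀ i, ∃ (L : ℝ) (c : Set ℂ) (q p : ℂ), (G i).Nonempty → IsPreconnected c ∧ c ⊆ U ∧ q ∈ c ∧
      p ∈ frontier U ∧ c ⊆ Metric.closedBall p ℓ ∧ y i ∉ sideOf U c z ∧ Reach U z q L ∧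
      L < sInf (G i) + ℓ := by
    intro i
    by_cases h : (G i).Nonempty
    · obtain ⟨L, ⟨c, q, p, h1, h2, h3, h4, h5, h6, h7⟩, hL⟩ :=
        exists_lt_of_csInf_lt h (lt_add_of_pos_right (sInf (G i)) (show 0 < ℓ by positivity))
      exact ⟨L, c, q, p, fun _ => ⟨h1, h2, h3, h4, h5, h6, h7, hL⟩⟩
    · exact ⟨0, ∅, 0, 0, fun h' => absurd h' h⟩
  choose L c q p hLc using this
  replace hLc := hGne.mono fun i hi => hLc i hi
  have hfc : IsCompact (frontier U) :=
    hbdd.isCompact_closure.of_isClosed_subset isClosed_frontier frontier_subset_closure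
  obtain ⟨o, ho, hpo⟩ := exists_tendsto_of_mem_isCompact 𝓤 hfc (hLc.mono fun i hi => hi.2.2.2.1)
  have hoU := hfr o ho
  have hdo := hd o ho
  have hcball : ∀ᶠ i in (𝓤 : Filter ℕ), ∀ v ∈ c i, dist v o < 2 * ℓ := by
    filter_upwards [hLc, hpo.eventually (Metric.ball_mem_nhds o (show 0 < ℓ by positivity))]
      with i hi hi' v hv
    have h1 := Metric.mem_closedBall.1 (hi.2.2.2.2.1 hv)
    have h2 := Metric.mem_ball.1 hi'
    linarith [dist_triangle v (p i) o]
  have : ∀ i, ∃ x : ℂ, (q i ∈ U ∧ dist (q i) o < 2 * ℓ) →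
      x ∈ U ∧ dist x o = r ∧ q i ∉ sideOf U (gate U o x) z := by
    intro i
    by_cases h : q i ∈ U ∧ dist (q i) o < 2 * ℓ
    · obtain ⟨x, h1, h2, h3⟩ := exists_gate_separating hU hsc h.1 hz
        (show dist (q i) o < r by linarith [h.2]) (show r < dist z o by linarith)
      exact ⟨x, fun _ => ⟨h1, h2, h3⟩⟩
    · exact ⟨0, fun h' => absurd h' h⟩
  choose x hx using this
  replace hx : ∀ᶠ i in (𝓤 : Filter ℕ), x i ∈ U ∧ dist (x i) o = r ∧
      q i ∉ sideOf U (gate U o (x i)) z := by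
    filter_upwards [hLc, hcball] with i h1 h2
    exact hx i ⟨h1.2.1 h1.2.2.1, h2 _ h1.2.2.1⟩
  have hze : ∀ x', dist x' o = r → z ∈ U \ gate U o x' := fun x' hx' =>
    ⟨hz, fun h => by
      have : dist z o = dist x' o := gate_subset_sphere h
      linarith⟩
  have hsep : ∀ᶠ i in (𝓤 : Filter ℕ), y i ∉ sideOf U (gate U o (x i)) z := by
    filter_upwards [hLc, hcball, hx] with i h1 h2 h3
    refine notMem_sideOf_of_separated h1.1 h1.2.1 ?_ h1.2.2.1 h3.2.2 (hze _ h3.2.1)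
      h1.2.2.2.2.2.1
    rw [disjoint_left]
    intro v hv hve
    have h4 := h2 v hv
    have : dist v o = dist (x i) o := gate_subset_sphere hve
    linarith [h3.2.1]
  by_cases hne : ∀ e : Set ℂ, ∀ᶠ i in (𝓤 : Filter ℕ), gate U o (x i) ≠ e
  · exfalso
    obtain ⟨p', hp', hsub⟩ := exists_gates_subset_closedBall hU hsc hbdd hoU 𝓤
      (hx.mono fun i hi => ⟨hi.1, hi.2.1⟩) hne (show 0 < ℓ by positivity)
    obtain ⟨i, h1, h2, h3, h4, h5⟩ :=
      (hLc.and (hcball.and (hx.and (hsep.and hsub)))).exists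
    obtain ⟨-, -, hq, -, -, -, hreach, hlt⟩ := h1
    obtain ⟨q', hq', L', hL', hle⟩ := hreach.exists_crossing (hze _ h3.2.1) h3.2.2
    have hmem : L' ∈ G i := ⟨gate U o (x i), q', p', isPreconnected_gate, gate_subset, hq', hp', h5,
      h4, hL'⟩
    have h6 := csInf_le (hGbdd i) hmem
    have h7 : dist q' o = dist (x i) o := gate_subset_sphere hq'
    linarith [dist_triangle q' (q i) o, h2 _ hq, h3.2.1]
  · push Not at hne
    obtain ⟨e, he⟩ := hne
    obtain ⟨i, h1, h2⟩ := (he.and hx).exists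
    refine ⟨o, ho, x i, h2.1, by linarith [h2.2.1], by linarith [h2.2.1], ?_⟩
    filter_upwards [he, hsep] with j h3 h4
    rwa [h1, ← h3]

/-- All circles around a suitable boundary point carry a gate cutting off the sequence. -/
theorem exists_frontier_gates {U : Set ℂ} (hU : IsOpen U) (hsc : IsSimplyConnected U)
    (hbdd : Bornology.IsBounded U) (𝓤 : Ultrafilter ℕ) {y : ℕ → ℂ} (hy : ∀ i, y i ∈ U) {b : ℂ}
    (hb : b ∈ frontier U) (hyb : Tendsto y 𝓤 (𝓝 b)) {z : ℂ} (hz : z ∈ U) :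
    ∃ w ∈ frontier U, ∀ ρ, 0 < ρ → ρ < dist z w → ∃ x ∈ U, dist x w = ρ ∧
      ∀ᶠ i in (𝓤 : Filter ℕ), y i ∉ sideOf U (gate U w x) z := by
  choose w hw x hxU hxw hxz hsep using fun k : ℕ =>
    exists_gate_eventually_separating hU hsc hbdd 𝓤 hy hb hyb hz (Nat.one_div_pos_of_nat (α := ℝ) (n := k))
  have hfc : IsCompact (frontier U) :=
    hbdd.isCompact_closure.of_isClosed_subset isClosed_frontier frontier_subset_closure
  obtain ⟨o, ho, hwo⟩ := exists_tendsto_of_mem_isCompact (hyperfilter ℕ) hfc (Eventually.of_forall hw)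
  refine ⟨o, ho, fun ρ hρ hρz => ?_⟩
  have h0 : Tendsto (fun k : ℕ => 1 / ((k : ℝ) + 1)) (hyperfilter ℕ) (𝓝 0) :=
    tendsto_one_div_add_atTop_nhds_zero_nat.mono_left Nat.hyperfilter_le_atTop
  obtain ⟨k, h1, h2⟩ := ((h0.eventually (gt_mem_nhds (show 0 < ρ / 4 by positivity))).and
    (hwo.eventually (Metric.ball_mem_nhds o (show 0 < ρ / 4 by positivity)))).exists
  have hball : ∀ v ∈ gate U (w k) (x k), dist v o < ρ := fun v hv => by
    have : dist v (w k) = dist (x k) (w k) := gate_subset_sphere hv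
    linarith [dist_triangle v (w k) o, hxw k]
  obtain ⟨x', hx'U, hx'o, hx'⟩ :=
    exists_gate_separating hU hsc (hxU k) hz (hball _ (mem_gate (hxU k))) hρz
  refine ⟨x', hx'U, hx'o, ?_⟩
  have hze : z ∈ U \ gate U o x' := ⟨hz, fun h => by
    have : dist z o = dist x' o := gate_subset_sphere h
    linarith⟩
  filter_upwards [hsep k] with i hi
  refine notMem_sideOf_of_separated isPreconnected_gate gate_subset ?_ (mem_gate (hxU k)) hx' hze hi
  rw [disjoint_left]
  intro v hv hve
  have : dist v o = dist x' o := gate_subset_sphere hve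
  linarith [hball v hv]

theorem IsCrossCut.subset {U γ : Set X} (h : IsCrossCut U γ) : γ ⊆ U := by
  obtain ⟨g, -, -, hg, -, -, rfl, -⟩ := h
  rintro _ ⟨t, ht, rfl⟩
  exact hg t ht

theorem IsCrossCut.isPreconnected {U γ : Set X} (h : IsCrossCut U γ) : IsPreconnected γ := by
  obtain ⟨g, hc, -, -, -, -, rfl, -⟩ := h
  exact isPreconnected_Ioo.image _ (hc.mono Ioo_subset_Icc_self)

theorem IsCrossCut.nonempty {U γ : Set X} (h : IsCrossCut U γ) : γ.Nonempty := by
  obtain ⟨g, -, -, -, -, -, rfl, -⟩ := h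
  exact (nonempty_Ioo.2 one_pos).image _

theorem IsCrossCut.isOpen_diff [T2Space X] {U γ : Set X} (hU : IsOpen U) (h : IsCrossCut U γ) :
    IsOpen (U \ γ) := by
  obtain ⟨g, hc, -, -, h0, h1, rfl, -⟩ := h
  have h0' : g 0 ∉ U := by rw [hU.frontier_eq] at h0; exact h0.2
  have h1' : g 1 ∉ U := by rw [hU.frontier_eq] at h1; exact h1.2
  have : U \ g '' Ioo 0 1 = U \ g '' Icc 0 1 := by
    ext p
    refine and_congr_right fun hp => not_congr ⟨fun h => image_mono Ioo_subset_Icc_self h, ?_⟩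
    rintro ⟨t, ht, rfl⟩
    refine ⟨t, ⟨ht.1.lt_of_ne ?_, ht.2.lt_of_ne ?_⟩, rfl⟩
    · rintro rfl; exact h0' hp
    · rintro rfl; exact h1' hp
  rw [this]
  exact hU.sdiff (isCompact_Icc.image_of_continuousOn hc).isClosed

theorem IsCrossSection.subset {U D : Set X} (h : IsCrossSection U D) : D ⊆ U := by
  obtain ⟨γ, -, x, -, rfl⟩ := h
  exact (connectedComponentIn_subset _ _).trans sdiff_subset

theorem IsCrossSection.isPreconnected {U D : Set X} (h : IsCrossSection U D) : IsPreconnected D := by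
  obtain ⟨γ, -, x, -, rfl⟩ := h
  exact isPreconnected_connectedComponentIn

theorem IsCrossSection.nonempty {U D : Set X} (h : IsCrossSection U D) : D.Nonempty := by
  obtain ⟨γ, -, x, hx, rfl⟩ := h
  exact ⟨x, mem_connectedComponentIn hx⟩

theorem IsCrossSection.isOpen [T2Space X] [LocallyConnectedSpace X] {U D : Set X} (hU : IsOpen U)
    (h : IsCrossSection U D) : IsOpen D := by
  obtain ⟨γ, hγ, x, -, rfl⟩ := h
  exact (hγ.isOpen_diff hU).connectedComponentIn

theorem IsCrossSection.isPreconnected_diff [T2Space X] [LocallyConnectedSpace X] {U D : Set X}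
    (hU : IsOpen U) (hUc : IsPreconnected U) (h : IsCrossSection U D) : IsPreconnected (U \ D) := by
  obtain ⟨γ, hγ, x, -, rfl⟩ := h
  exact isPreconnected_diff_connectedComponentIn hUc hγ.isPreconnected hγ.subset hγ.nonempty
    (hγ.isOpen_diff hU) x

theorem IsCrossSection.diff_nonempty {U D : Set X} (h : IsCrossSection U D) : (U \ D).Nonempty := by
  obtain ⟨γ, hγ, x, -, rfl⟩ := h
  obtain ⟨p, hp⟩ := hγ.nonempty
  exact ⟨p, hγ.subset hp, fun h => (connectedComponentIn_subset _ _ h).2 hp⟩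

theorem IsCrossSection.frontier_inter_nonempty {U D : Set X} (h : IsCrossSection U D) :
    (frontier U ∩ frontier D).Nonempty := by
  obtain ⟨γ, ⟨-, -, -, -, -, -, -, D₁, D₂, ⟨-, -, -, h12⟩, ⟨p₁, h1, h1', -⟩, ⟨p₂, h2, h2', -⟩⟩, x, hx, rfl⟩ := h
  rcases h12 x hx with h | h
  · exact ⟨p₁, h1', h ▸ h1⟩
  · exact ⟨p₂, h2', h ▸ h2⟩

theorem exists_isCompact_isPreconnected_superset {U : Set ℂ} (hU : IsOpen U) (hUc : IsPreconnected U)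
    {z : ℂ} (hz : z ∈ U) {K : Set ℂ} (hK : IsCompact K) (hKU : K ⊆ U) :
    ∃ K', IsCompact K' ∧ IsPreconnected K' ∧ K ⊆ K' ∧ K' ⊆ U ∧ z ∈ K' := by
  have hpc : IsPathConnected U := hU.isConnected_iff_isPathConnected.1 ⟨⟨z, hz⟩, hUc⟩
  suffices ∃ K', K ⊆ K' ∧ IsCompact K' ∧ IsPreconnected K' ∧ K' ⊆ U ∧ z ∈ K' by
    obtain ⟨K', h1, h2, h3, h4, h5⟩ := this
    exact ⟨K', h2, h3, h1, h4, h5⟩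
  refine hK.induction_on (p := fun s => ∃ K', s ⊆ K' ∧ IsCompact K' ∧ IsPreconnected K' ∧ K' ⊆ U ∧
    z ∈ K') ⟨{z}, empty_subset _, isCompact_singleton, isPreconnected_singleton,
      singleton_subset_iff.2 hz, rfl⟩ ?_ ?_ ?_
  · rintro s t hst ⟨K', h, h'⟩
    exact ⟨K', hst.trans h, h'⟩
  · rintro s t ⟨K', h1, h2, h3, h4, h5⟩ ⟨L', g1, g2, g3, g4, g5⟩
    exact ⟨K' ∪ L', union_subset_union h1 g1, h2.union g2, h3.union z h5 g5 g3, union_subset h4 g4,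
      Or.inl h5⟩
  · intro x hx
    obtain ⟨ε, hε, hball⟩ := Metric.nhds_basis_closedBall.mem_iff.1 (hU.mem_nhds (hKU hx))
    obtain ⟨γ, hγ⟩ := hpc.joinedIn x (hKU hx) z hz
    refine ⟨Metric.closedBall x ε, mem_nhdsWithin_of_mem_nhds (Metric.closedBall_mem_nhds x hε),
      Metric.closedBall x ε ∪ range γ, subset_union_left,
      (isCompact_closedBall x ε).union (isCompact_range γ.continuous), ?_, ?_, ?_⟩
    · exact (convex_closedBall x ε).isPreconnected.union x (Metric.mem_closedBall_self hε.le)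
        ⟨0, γ.source⟩ (isPreconnected_range γ.continuous)
    · exact union_subset hball (range_subset_iff.2 hγ)
    · exact Or.inr ⟨1, γ.target⟩

/-- A set close to a boundary point does not separate a given compact set. -/
theorem exists_subset_sideOf {U : Set ℂ} (hU : IsOpen U) (hUc : IsPreconnected U)
    {z w : ℂ} (hz : z ∈ U) (hw : w ∉ U) {K : Set ℂ} (hK : IsCompact K) (hKU : K ⊆ U) :
    ∃ ρ, 0 < ρ ∧ Disjoint (Metric.closedBall w ρ) K ∧
      ∀ c ⊆ Metric.closedBall w ρ, K ⊆ sideOf U c z := by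
  obtain ⟨K', h1, h2, h3, h4, h5⟩ := exists_isCompact_isPreconnected_superset hU hUc hz hK hKU
  obtain ⟨ρ, hρ, hd⟩ := Metric.nhds_basis_closedBall.mem_iff.1
    (h1.isClosed.isOpen_compl.mem_nhds (fun h => hw (h4 h)))
  refine ⟨ρ, hρ, disjoint_left.2 fun p hp hpK => hd hp (h3 hpK), fun c hc => ?_⟩
  exact h3.trans (h2.subset_connectedComponentIn h5 fun p hp => ⟨h4 hp, fun hpc => hd (hc hpc) hp⟩)

theorem bdIn_farSide_subset {U c : Set ℂ} (ho : IsOpen (U \ c)) {z : ℂ} :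
    bdIn U (farSide U c z) ⊆ c := by
  rintro p ⟨⟨hp, hpE⟩, hpU⟩
  by_contra hpc
  have hpS : p ∈ sideOf U c z := by
    by_contra hpS; exact hpE ⟨⟨hpU, hpc⟩, hpS⟩
  obtain ⟨q, hq, hq'⟩ := mem_closure_iff.1 hp _ ho.connectedComponentIn hpS
  exact hq'.2 hq

theorem diff_sideOf_subset_of_mem {U c : Set ℂ} {z : ℂ} {D : Set ℂ} (hUc : IsPreconnected U)
    (hU : IsOpen U) (hD : IsCrossSection U D) (hc : IsPreconnected c) (hcU : c ⊆ U)
    (hcD : Disjoint c (bdIn U D)) (hz : z ∈ U \ D) {p y : ℂ}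
    (hp : p ∈ D) (hpc : p ∈ sideOf U c z) (hy : y ∈ D) (hyc : y ∉ sideOf U c z) :
    U \ sideOf U c z ⊆ D := by
  by_cases hcm : (c ∩ D).Nonempty
  · have hcD' : c ⊆ D := by
      refine hc.subset_of_disjoint_frontier hcm (eq_empty_iff_forall_notMem.2 ?_)
      rintro q ⟨hq, hqf⟩
      rw [(hD.isOpen hU).frontier_eq] at hqf
      exact disjoint_left.1 hcD hq ⟨hqf, hcU hq⟩
    have : U \ D ⊆ sideOf U c z :=
      (hD.isPreconnected_diff hU hUc).subset_connectedComponentIn hz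
        fun q hq => ⟨hq.1, fun hqc => hq.2 (hcD' hqc)⟩
    rintro q ⟨hqU, hq⟩
    by_contra hqD
    exact hq (this ⟨hqU, hqD⟩)
  · refine absurd (subset_connectedComponentIn_of_mem (W := U \ c) hD.isPreconnected
      (fun q hq => ⟨hD.subset hq, fun hqc => hcm ⟨q, hqc, hq⟩⟩) hp hpc hy) hyc

theorem diff_sideOf_subset_farSide {U c e : Set ℂ} {z x y : ℂ} (hUc : IsPreconnected U)
    (hce : Disjoint c e) (hc : IsPreconnected c) (he : IsPreconnected e) (hcU : c ⊆ U) (heU : e ⊆ U)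
    (hen : e.Nonempty) (hoe : IsOpen (U \ e))
    (hx : x ∈ c) (hxe : x ∈ sideOf U e z) (hyU : y ∈ U) (hyc : y ∉ sideOf U c z)
    (hye : y ∉ sideOf U e z) : U \ sideOf U e z ⊆ farSide U c z := by
  have hcS : c ⊆ sideOf U e z := subset_connectedComponentIn_of_mem (W := U \ e) hc
    (fun q hq => ⟨hcU hq, disjoint_left.1 hce hq⟩) hx hxe
  have hM : IsPreconnected (U \ sideOf U e z) :=
    isPreconnected_diff_connectedComponentIn hUc he heU hen hoe z
  have hMc : U \ sideOf U e z ⊆ U \ c := fun q hq => ⟨hq.1, fun hqc => hq.2 (hcS hqc)⟩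
  intro q hq
  refine ⟨hMc hq, fun hqS => hyc ?_⟩
  exact subset_connectedComponentIn_of_mem hM hMc hq hqS ⟨hyU, hye⟩

/-- A prime chain is eventually beyond arbitrarily small gates around some boundary point. -/
theorem IsPrimeChain.exists_gates {U : Set ℂ} (hU : IsOpen U) (hsc : IsSimplyConnected U)
    (hbdd : Bornology.IsBounded U) {D : ℕ → Set ℂ} (hD : IsPrimeChain U D) :
    ∃ z ∈ U, ∃ w ∈ frontier U, ∀ ε > 0, ∃ x ∈ U, dist x w < ε ∧ dist x w < dist z w ∧
      ∃ m, D m ⊆ farSide U (gate U w x) z := by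
  have hUc : IsPreconnected U := hsc.isPathConnected.isConnected.isPreconnected
  obtain ⟨⟨hsec, hanti, hdisj⟩, hprime⟩ := hD
  obtain ⟨z, hzU, hzD⟩ := (hsec 0).diff_nonempty
  have hzD : ∀ m, z ∈ U \ D m := fun m => ⟨hzU, fun h => hzD (hanti m 0 (Nat.zero_le m) h)⟩
  have hfc : IsCompact (frontier U) :=
    hbdd.isCompact_closure.of_isClosed_subset isClosed_frontier frontier_subset_closure
  have : ∀ i : ℕ, ∃ b ∈ frontier U, ∃ y ∈ D i, dist y b < 1 / ((i : ℝ) + 1) := by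
    intro i
    obtain ⟨b, hb, hb'⟩ := (hsec i).frontier_inter_nonempty
    obtain ⟨y, hy, hyb⟩ := Metric.mem_closure_iff.1 hb'.1 _ (Nat.one_div_pos_of_nat (α := ℝ) (n := i))
    exact ⟨b, hb, y, hy, by rwa [dist_comm]⟩
  choose b hb y hyD hyb using this
  have hyU : ∀ i, y i ∈ U := fun i => (hsec i).subset (hyD i)
  obtain ⟨b₀, hb₀, hbb⟩ :=
    exists_tendsto_of_mem_isCompact (hyperfilter ℕ) hfc (Eventually.of_forall hb)
  have h0 : Tendsto (fun k : ℕ => 1 / ((k : ℝ) + 1)) (hyperfilter ℕ) (𝓝 0) :=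
    tendsto_one_div_add_atTop_nhds_zero_nat.mono_left Nat.hyperfilter_le_atTop
  have hyb₀ : Tendsto y (hyperfilter ℕ) (𝓝 b₀) :=
    hbb.congr_dist (squeeze_zero (fun _ => dist_nonneg)
      (fun i => by rw [dist_comm]; exact (hyb i).le) h0)
  obtain ⟨w, hw, hgates⟩ := exists_frontier_gates hU hsc hbdd (hyperfilter ℕ) hyU hb₀ hyb₀ hzU
  have hwU : w ∉ U := by rw [hU.frontier_eq] at hw; exact hw.2
  have hyDm : ∀ m, ∀ᶠ i in (hyperfilter ℕ : Filter ℕ), y i ∈ D m := fun m =>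
    ((eventually_ge_atTop m).filter_mono Nat.hyperfilter_le_atTop).mono
      fun i hi => hanti i m hi (hyD i)
  let P : ℂ → Prop := fun x => x ∈ U ∧ dist x w < dist z w ∧
    ∀ᶠ i in (hyperfilter ℕ : Filter ℕ), y i ∉ sideOf U (gate U w x) z
  have hsmall : ∀ ε > 0, ∃ x, P x ∧ dist x w < ε := by
    intro ε hε
    obtain ⟨ρ, hρ0, hρ⟩ := exists_between (lt_min hε (dist_pos.2 fun h : z = w => hwU (h ▸ hzU)))
    obtain ⟨x, h1, h2, h3⟩ := hgates ρ hρ0 (hρ.trans_le (min_le_right _ _))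
    exact ⟨x, ⟨h1, h2.trans_lt (hρ.trans_le (min_le_right _ _)), h3⟩,
      h2.trans_lt (hρ.trans_le (min_le_left _ _))⟩
  have hcut : ∀ x, P x → IsCrossCut U (gate U w x) := fun x hx => isCrossCut_gate hU hsc hbdd hwU hx.1
  have hzc : ∀ x, P x → z ∈ U \ gate U w x := fun x hx => ⟨hzU, fun h => by
    have : dist z w = dist x w := gate_subset_sphere h
    linarith [hx.2.1]⟩
  have hball : ∀ x ρ, dist x w < ρ → gate U w x ⊆ Metric.closedBall w ρ := fun x ρ h p hp => by
    have : dist p w = dist x w := gate_subset_sphere hp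
    rw [Metric.mem_closedBall]; linarith
  have hnext : ∀ x : {x // P x}, ∃ x' : {x // P x}, dist x'.1 w < dist x.1 w / 2 ∧
      U \ sideOf U (gate U w x'.1) z ⊆ farSide U (gate U w x.1) z := by
    rintro ⟨x, hx⟩
    obtain ⟨ρ, hρ, -, hsub⟩ := exists_subset_sideOf hU hUc hzU hwU (isCompact_singleton (x := x))
      (singleton_subset_iff.2 hx.1)
    have hxw : 0 < dist x w := dist_pos.2 fun h => hwU (h ▸ hx.1)
    obtain ⟨x', hx', hlt⟩ := hsmall _ (lt_min hρ (half_pos hxw))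
    rw [lt_min_iff] at hlt
    obtain ⟨i, hi1, hi2⟩ := (hx.2.2.and hx'.2.2).exists
    refine ⟨⟨x', hx'⟩, hlt.2, diff_sideOf_subset_farSide hUc ?_ isPreconnected_gate
      isPreconnected_gate gate_subset gate_subset (hcut x' hx').nonempty
      ((hcut x' hx').isOpen_diff hU) (mem_gate hx.1) (hsub _ (hball _ _ hlt.1) rfl) (hyU i) hi1 hi2⟩
    rw [disjoint_left]
    intro p hp hp'
    have h1 : dist p w = dist x w := gate_subset_sphere hp
    have h2 : dist p w = dist x' w := gate_subset_sphere hp'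
    linarith
  choose next hlt hM using hnext
  obtain ⟨x₀, hx₀, -⟩ := hsmall 1 one_pos
  let s : ℕ → {x // P x} := fun n => Nat.rec ⟨x₀, hx₀⟩ (fun _ x => next x) n
  have hs : ∀ n, s (n + 1) = next (s n) := fun n => rfl
  have hsle : ∀ n, dist (s n).1 w ≤ dist x₀ w * (1 / 2) ^ n := by
    intro n
    induction n with
    | zero => simp [s]
    | succ n ih =>
      rw [hs, pow_succ]
      linarith [hlt (s n)]
  have hs0 : Tendsto (fun n => dist (s n).1 w) atTop (𝓝 0) := by
    refine squeeze_zero (fun _ => dist_nonneg) hsle ?_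
    simpa using (tendsto_pow_atTop_nhds_zero_of_lt_one (by norm_num) (by norm_num :
      (1 / 2 : ℝ) < 1)).const_mul (dist x₀ w)
  let E : ℕ → Set ℂ := fun n => farSide U (gate U w (s n).1) z
  have hMsup : ∀ x, farSide U (gate U w x) z ⊆ U \ sideOf U (gate U w x) z :=
    fun x p hp => ⟨hp.1.1, hp.2⟩
  have hEanti : Antitone E := antitone_nat_of_succ_le fun n => by
    show farSide U (gate U w (s (n + 1)).1) z ⊆ _
    rw [hs]; exact (hMsup _).trans (hM (s n))
  have hdist : StrictAnti fun n => dist (s n).1 w := strictAnti_nat_of_succ_lt fun n => by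
    have : 0 < dist (s n).1 w := dist_pos.2 fun h => hwU (h ▸ (s n).2.1)
    rw [hs]; linarith [hlt (s n)]
  have hbd : ∀ n, closure (bdIn U (E n)) ⊆ Metric.sphere w (dist (s n).1 w) := fun n =>
    closure_minimal ((bdIn_farSide_subset ((hcut _ (s n).2).isOpen_diff hU)).trans
      gate_subset_sphere) Metric.isClosed_sphere
  have hE : IsPEChain U E := by
    refine ⟨fun i => isCrossSection_farSide (hcut _ (s i).2) (hzc _ (s i).2),
      fun i j hij => hEanti hij, fun i j hij => eq_empty_iff_forall_notMem.2 ?_⟩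
    rintro p ⟨hp, hp'⟩
    have h1 : dist p w = dist (s i).1 w := hbd i hp
    have h2 : dist p w = dist (s j).1 w := hbd j hp'
    exact hij (hdist.injective (h1.symm.trans h2))
  have hdivw : ∀ m, w ∉ closure (bdIn U (D m)) → ∃ n, E n ⊆ D m := by
    intro m hwm
    obtain ⟨p, hp⟩ := (hsec m).nonempty
    obtain ⟨ρ₁, hρ₁, hd⟩ := Metric.nhds_basis_closedBall.mem_iff.1
      (isClosed_closure.isOpen_compl.mem_nhds hwm)
    obtain ⟨ρ₂, hρ₂, -, hsub⟩ := exists_subset_sideOf hU hUc hzU hwU (isCompact_singleton (x := p))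
      (singleton_subset_iff.2 ((hsec m).subset hp))
    obtain ⟨n, hn1, hn2⟩ := ((hs0.eventually (gt_mem_nhds hρ₁)).and
      (hs0.eventually (gt_mem_nhds hρ₂))).exists
    obtain ⟨i, hi1, hi2⟩ := ((hyDm m).and (s n).2.2.2).exists
    refine ⟨n, (hMsup _).trans (diff_sideOf_subset_of_mem hUc hU (hsec m) isPreconnected_gate
      gate_subset ?_ (hzD m) hp (hsub _ (hball _ _ hn2) rfl) hi1 hi2)⟩
    exact disjoint_left.2 fun q hq hq' => hd (hball _ _ hn1 hq) (subset_closure hq')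
  have hdiv : ChainDivides E D := by
    intro m
    by_cases hwm : w ∈ closure (bdIn U (D m))
    · obtain ⟨n, hn⟩ := hdivw (m + 1) fun h => by
        have : w ∈ closure (bdIn U (D m)) ∩ closure (bdIn U (D (m + 1))) := ⟨hwm, h⟩
        rwa [hdisj m (m + 1) (by omega)] at this
      exact ⟨n, hn.trans (hanti (m + 1) m (by omega))⟩
    · exact hdivw m hwm
  refine ⟨z, hzU, w, hw, fun ε hε => ?_⟩
  obtain ⟨n, hn⟩ := (hs0.eventually (gt_mem_nhds hε)).exists
  exact ⟨(s n).1, (s n).2.1, hn, (s n).2.2.1, hprime E hE hdiv n⟩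

theorem isSimplyConnected_univ_complex : IsSimplyConnected (univ : Set ℂ) := by
  have := convex_univ.contractibleSpace (E := ℂ) univ_nonempty
  exact SimplyConnectedSpace.ofContractible ↥(univ : Set ℂ)

/-- A homeomorphism pushing a far side strictly into itself has a cross-section inside a
fundamental domain. -/
theorem exists_section_subset_farSide {U : Set ℂ} (hU : IsOpen U) (hsc : IsSimplyConnected U)
    (hbdd : Bornology.IsBounded U) (h : ℂ ≃ₜ ℂ) (hhU : h '' U = U) {w x z : ℂ} (hw : w ∉ U)
    (hx : x ∈ U) (hz : z ∈ U) (hxz : dist x w < dist z w)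
    (hdis : Disjoint (Metric.closedBall w (dist x w)) (h '' Metric.closedBall w (dist x w)))
    (hM : h '' (U \ sideOf U (gate U w x) z) ⊆ farSide U (gate U w x) z) :
    ∃ W, IsCrossSection U W ∧ W ⊆ farSide U (gate U w x) z ∧
      Disjoint W (h '' (U \ sideOf U (gate U w x) z)) := by
  have hUc : IsPreconnected U := hsc.isPathConnected.isConnected.isPreconnected
  have hr0 : 0 < dist x w := dist_pos.2 fun h => hw (h ▸ hx)
  set B := Metric.closedBall w (dist x w) with hB
  set e := gate U w x with he
  set S := sideOf U e z with hS
  set E := farSide U e z with hE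
  set M := U \ S with hMdef
  have hze : z ∈ U \ e := ⟨hz, fun h => by
    have : dist z w = dist x w := gate_subset_sphere h
    linarith⟩
  have hcut : IsCrossCut U e := isCrossCut_gate hU hsc hbdd hw hx
  have heo : IsOpen (U \ e) := hcut.isOpen_diff hU
  have hsec : IsCrossSection U E := isCrossSection_farSide hcut hze
  have hEo : IsOpen E := hsec.isOpen hU
  have hSo : IsOpen S := heo.connectedComponentIn
  have hMeq : M = e ∪ E := diff_sideOf_eq gate_subset
  have heB : e ⊆ B := gate_subset_sphere.trans Metric.sphere_subset_closedBall
  have hEM : E ⊆ M := fun p hp => ⟨hp.1.1, hp.2⟩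
  have heM : e ⊆ M := hMeq ▸ subset_union_left
  have hzS : z ∈ S := mem_connectedComponentIn hze
  have hMpre : IsPreconnected M :=
    isPreconnected_diff_connectedComponentIn hUc hcut.isPreconnected hcut.subset hcut.nonempty heo z
  have hmaps : ∀ p, h p ∈ U ↔ p ∈ U := fun p => by
    conv_lhs => rw [← hhU]
    exact h.injective.mem_set_image
  set R := E \ h '' M with hR
  have hhS : h '' S = U \ h '' M := by
    rw [hMdef, image_sdiff h.injective, hhU]
    ext p
    have h1 : h '' S ⊆ U := hhU ▸ image_mono (connectedComponentIn_subset _ _ |>.trans sdiff_subset)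
    have h2 := @h1 p
    simp only [Set.mem_sdiff]
    tauto
  have hReq : R = E ∩ h '' S := by
    rw [hhS]
    ext p
    have : p ∈ E → p ∈ U := fun hp => hp.1.1
    simp only [hR, Set.mem_sdiff, mem_inter_iff]
    tauto
  have hfE : frontier E ⊆ (U \ e)ᶜ := by
    obtain ⟨v, -, hv⟩ := isCompOf_farSide hcut hze
    intro p hp
    rw [hE, hv] at hp
    exact notMem_of_mem_frontier_connectedComponentIn heo hp
  have hfS : frontier (h '' S) ⊆ (U \ h '' e)ᶜ := by
    rw [← h.image_frontier]
    rintro _ ⟨p, hp, rfl⟩ ⟨h1, h2⟩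
    exact notMem_of_mem_frontier_connectedComponentIn heo hp
      ⟨(hmaps p).1 h1, fun h => h2 (mem_image_of_mem _ h)⟩
  have hfR : ∀ p ∈ frontier R, p ∈ U → p ∈ e ∪ h '' e := by
    intro p hp hpU
    rw [hReq] at hp
    rcases frontier_inter_subset _ _ hp with h1 | h1
    · left; by_contra h2; exact hfE h1.1 ⟨hpU, h2⟩
    · right; by_contra h2; exact hfS h1.2 ⟨hpU, h2⟩
  have hBc : IsClosed B := Metric.isClosed_closedBall
  have hhBc : IsClosed (h '' B) := h.isClosedMap _ hBc
  have hRout : ∃ q ∈ R, q ∉ B ∧ q ∉ h '' B := by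
    have hpre : IsPreconnected (M ∩ h '' (U \ E)) := by
      refine IsPreconnected.inter_of_relClosed hU hsc hMpre
        ((hsec.isPreconnected_diff hU hUc).image _ h.continuous.continuousOn) ?_ ?_ ?_
      · ext p
        constructor
        · rintro (hp | ⟨p, hp, rfl⟩)
          · exact hp.1
          · exact (hmaps p).2 hp.1
        · intro hp
          by_cases hpM : p ∈ M
          · exact Or.inl hpM
          · right
            obtain ⟨q, rfl⟩ := h.surjective p
            refine ⟨q, ⟨(hmaps q).1 hp, fun hq => hpM (hEM (hM ⟨q, hEM hq, rfl⟩))⟩, rfl⟩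
      · rintro p ⟨hp, hpU⟩
        refine ⟨hpU, fun hpS => ?_⟩
        obtain ⟨q, hq, hq'⟩ := mem_closure_iff.1 hp _ hSo hpS
        exact hq'.2 hq
      · rintro p ⟨hp, hpU⟩
        obtain ⟨q, rfl⟩ := h.surjective p
        refine ⟨q, ⟨(hmaps q).1 hpU, fun hq => ?_⟩, rfl⟩
        obtain ⟨v, hv, v', hv', rfl⟩ := mem_closure_iff.1 hp _ (h.isOpenMap _ hEo) ⟨q, hq, rfl⟩
        exact hv'.2 (h.injective.mem_set_image.1 hv)
    by_contra! hno
    have hcov : M ∩ h '' (U \ E) ⊆ B ∪ h '' B := by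
      rintro _ ⟨hp, p, hp', rfl⟩
      by_contra hpB
      rw [mem_union, not_or] at hpB
      refine hpB.2 (hno _ ⟨?_, ?_⟩ hpB.1)
      · rw [hMeq] at hp
        exact hp.resolve_left fun h => hpB.1 (heB h)
      · rintro ⟨q, hq, hqp⟩
        have hq' : q = p := h.injective hqp
        subst hq'
        rw [hMeq] at hq
        exact hq.elim (fun h' => hpB.2 (mem_image_of_mem _ (heB h'))) hp'.2
    have hxe : x ∈ e := mem_gate hx
    have hhxE : h x ∈ E := hM ⟨x, heM hxe, rfl⟩
    have hxE : x ∉ E := fun h => h.1.2 hxe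
    have hxM : x ∈ h '' (U \ E) := by
      obtain ⟨q, hq⟩ := h.surjective x
      refine ⟨q, ⟨(hmaps q).1 (hq ▸ hx), fun hqE => hxE ?_⟩, hq⟩
      rw [← hq]
      exact hM ⟨q, hEM hqE, rfl⟩
    obtain ⟨p, -, hp1, hp2⟩ := isPreconnected_closed_iff.1 hpre B (h '' B) hBc hhBc hcov
      ⟨x, ⟨heM hxe, hxM⟩, heB hxe⟩
      ⟨h x, ⟨hEM hhxE, x, ⟨hx, hxE⟩, rfl⟩, x, heB hxe, rfl⟩
    exact disjoint_left.1 hdis hp1 hp2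
  have hRU : R ⊆ U := fun p hp => hp.1.1.1
  obtain ⟨b, hb, hbR, hbB⟩ : ∃ b, b ∉ U ∧ b ∈ closure R ∧ b ∉ B ∪ h '' B := by
    by_contra! hno
    have hO : IsPreconnected (Bᶜ ∩ (h '' B)ᶜ) := by
      refine IsPreconnected.inter_of_isOpen isOpen_univ isSimplyConnected_univ_complex
        (isPreconnected_compl_closedBall w hr0) ?_ ?_ hBc.isOpen_compl hhBc.isOpen_compl
      · rw [← image_compl_eq h.bijective]
        exact (isPreconnected_compl_closedBall w hr0).image _ h.continuous.continuousOn
      · rw [← compl_inter, hdis.inter_eq, compl_empty]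
    obtain ⟨q, hq, hqB, hqhB⟩ := hRout
    have hOR := hO.subset_of_disjoint_frontier (V := R) ⟨q, ⟨hqB, hqhB⟩, hq⟩ (by
      rw [eq_empty_iff_forall_notMem]
      rintro p ⟨⟨hp1, hp2⟩, hp⟩
      by_cases hpU : p ∈ U
      · exact (hfR p hp hpU).elim (fun h => hp1 (heB h)) fun h' => hp2 (image_mono heB h')
      · exact (hno p hpU hp.1).elim hp1 hp2)
    have hbd : Bornology.IsBounded (R ∪ (B ∪ h '' B)) :=
      (hbdd.subset hRU).union (Metric.isBounded_closedBall.union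
        ((isCompact_closedBall _ _).image h.continuous).isBounded)
    have huniv : R ∪ (B ∪ h '' B) = univ := by
      rw [eq_univ_iff_forall]
      intro p
      by_cases h1 : p ∈ B
      · exact Or.inr (Or.inl h1)
      · by_cases h2 : p ∈ h '' B
        · exact Or.inr (Or.inr h2)
        · exact Or.inl (hOR ⟨h1, h2⟩)
    rw [huniv] at hbd
    exact NoncompactSpace.noncompact_univ (X := ℂ) (Metric.isCompact_of_isClosed_isBounded isClosed_univ hbd)
  obtain ⟨ρ₁, hρ₁, hd₁, hsub₁⟩ := exists_subset_sideOf hU hUc hz hb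
    (K := {x, h x, z}) (by simp) (by
      rintro p (rfl | rfl | rfl)
      exacts [hx, (hmaps _).2 hx, hz])
  obtain ⟨ρ₂, hρ₂, hd₂⟩ := Metric.nhds_basis_closedBall.mem_iff.1
    ((hBc.union hhBc).isOpen_compl.mem_nhds hbB)
  set ρ := min ρ₁ ρ₂ with hρ
  have hρ0 : 0 < ρ := lt_min hρ₁ hρ₂
  obtain ⟨y, hyR, hyb⟩ := Metric.mem_closure_iff.1 hbR ρ hρ0
  rw [dist_comm] at hyb
  have hzb : ρ < dist z b := by
    by_contra! hle
    exact disjoint_left.1 hd₁ (Metric.mem_closedBall.2 (hle.trans (min_le_left _ _))) (by simp)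
  obtain ⟨x', hx'U, hx'b, hyx'⟩ := exists_gate_separating hU hsc (hRU hyR) hz hyb hzb
  set c := gate U b x' with hc
  have hcb : c ⊆ Metric.closedBall b ρ :=
    gate_subset_sphere.trans (hx'b ▸ Metric.sphere_subset_closedBall)
  have hcb₁ : c ⊆ Metric.closedBall b ρ₁ := hcb.trans (Metric.closedBall_subset_closedBall (min_le_left _ _))
  have hcB : ∀ p ∈ c, p ∉ B ∪ h '' B := fun p hp =>
    hd₂ (Metric.closedBall_subset_closedBall (min_le_right _ _) (hcb hp))
  have hsub := hsub₁ c hcb₁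
  have hcut' : IsCrossCut U c := isCrossCut_gate hU hsc hbdd hb hx'U
  have hzc : z ∈ U \ c := ⟨hz, fun h => by
    have := Metric.mem_closedBall.1 (hcb h)
    linarith⟩
  have heS : e ⊆ sideOf U c z := subset_connectedComponentIn_of_mem (W := U \ c) isPreconnected_gate
    (fun p hp => ⟨gate_subset hp, fun hpc => hcB p hpc (Or.inl (heB hp))⟩) (mem_gate hx)
    (hsub (by simp))
  have hheS : h '' e ⊆ sideOf U c z := by
    refine subset_connectedComponentIn_of_mem (W := U \ c)
      (isPreconnected_gate.image _ h.continuous.continuousOn) ?_ (mem_image_of_mem _ (mem_gate hx))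
      (hsub (by simp))
    rintro _ ⟨p, hp, rfl⟩
    exact ⟨(hmaps p).2 (gate_subset hp), fun hpc => hcB _ hpc (Or.inr ⟨p, heB hp, rfl⟩)⟩
  have hM' : U \ sideOf U c z ⊆ R := by
    refine (isPreconnected_diff_connectedComponentIn hUc hcut'.isPreconnected hcut'.subset
      hcut'.nonempty (hcut'.isOpen_diff hU) z).subset_of_disjoint_frontier
      ⟨y, ⟨hRU hyR, hyx'⟩, hyR⟩ (eq_empty_iff_forall_notMem.2 ?_)
    rintro p ⟨⟨hpU, hpS⟩, hpf⟩
    exact hpS ((hfR p hpf hpU).elim (fun h => heS h) fun h => hheS h)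
  have hW : farSide U c z ⊆ R := (fun p hp => hM' ⟨hp.1.1, hp.2⟩)
  exact ⟨farSide U c z, isCrossSection_farSide hcut' hzc, fun p hp => (hW hp).1,
    disjoint_left.2 fun p hp => (hW hp).2⟩

theorem iterZ_one_mul_natCast (f : X ≃ₜ X) (n : ℕ) (A : Set X) :
    iterZ f (((1 : ℕ) : ℤ) * n) A = f^[n] '' A := by
  rw [iterZ, Nat.cast_one, one_mul, zpow_natCast]
  exact congrArg (· '' A) (Equiv.Perm.iterate_eq_pow f.toEquiv n).symm

theorem iterZ_one_mul_neg_natCast (f : X ≃ₜ X) (n : ℕ) (A : Set X) :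
    iterZ f (((1 : ℕ) : ℤ) * -n) A = f.symm^[n] '' A := by
  rw [iterZ, Nat.cast_one, one_mul, zpow_neg, ← inv_zpow, zpow_natCast]
  exact congrArg (· '' A) (Equiv.Perm.iterate_eq_pow f.symm.toEquiv n).symm

theorem disjoint_image_symm_iterate (f : X ≃ₜ X) {n : ℕ} {W : Set X} (h : Disjoint W (f^[n] '' W)) :
    Disjoint W (f.symm^[n] '' W) := by
  rw [disjoint_left] at h ⊢
  rintro _ hp ⟨q, hq, rfl⟩
  exact h hq ⟨_, hp, Function.LeftInverse.iterate f.apply_symm_apply n q⟩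

/-- A wandering cross-section whose forward orbit avoids `K`, for `f` or its inverse. -/
theorem exists_section_orbit_disjoint {U : Set ℂ} (hU : IsOpen U) (hsc : IsSimplyConnected U)
    (hbdd : Bornology.IsBounded U) (h : ℂ ≃ₜ ℂ) (hhU : h '' U = U) {w x z : ℂ} (hw : w ∉ U)
    (hx : x ∈ U) (hz : z ∈ U) (hxz : dist x w < dist z w)
    (hdis : Disjoint (Metric.closedBall w (dist x w)) (h '' Metric.closedBall w (dist x w)))
    (hM : h '' (U \ sideOf U (gate U w x) z) ⊆ farSide U (gate U w x) z) {K : Set ℂ}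
    (hK : K ⊆ sideOf U (gate U w x) z) :
    ∃ W, IsCrossSection U W ∧ ∀ n : ℕ, 0 < n →
      Disjoint W (h^[n] '' W) ∧ Disjoint (h^[n] '' W) K := by
  obtain ⟨W, hW, hWE, hWd⟩ := exists_section_subset_farSide hU hsc hbdd h hhU hw hx hz hxz hdis hM
  set M := U \ sideOf U (gate U w x) z
  have hEM : farSide U (gate U w x) z ⊆ M := fun p hp => ⟨hp.1.1, hp.2⟩
  have hit : ∀ n : ℕ, h^[n + 1] '' W ⊆ h '' M := by
    intro n
    induction n with
    | zero => simpa only [zero_add, Function.iterate_one] using image_mono (hWE.trans hEM)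
    | succ n ih =>
      rw [Function.iterate_succ', image_comp]
      exact image_mono ((ih.trans hM).trans hEM)
  refine ⟨W, hW, fun n hn => ?_⟩
  obtain ⟨n, rfl⟩ := Nat.exists_eq_succ_of_ne_zero hn.ne'
  exact ⟨hWd.mono_right (hit n),
    disjoint_left.2 fun p hp hpK => (hEM (hM (hit n hp))).2 (hK hpK)⟩

theorem isWanderingSection_one (f : X ≃ₜ X) {U W : Set X} (hW : IsCrossSection U W)
    (h : ∀ n : ℕ, 0 < n → Disjoint W (f^[n] '' W)) : IsWanderingSection f U 1 W := by
  refine ⟨hW, fun k hk => ?_⟩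
  rw [← disjoint_iff_inter_eq_empty, disjoint_comm]
  obtain ⟨n, rfl | rfl⟩ := k.eq_nat_or_neg
  · rw [iterZ_one_mul_natCast]
    exact h n (by omega)
  · rw [iterZ_one_mul_neg_natCast]
    exact disjoint_image_symm_iterate f (h n (by omega))

theorem exists_fixed_of_invariant_primeChain {U : Set ℂ} (hU : IsOpen U) (hsc : IsSimplyConnected U)
    (hbdd : Bornology.IsBounded U) (f : ℂ ≃ₜ ℂ) (hfU : f '' U = U) (hbnw : BdNonwandering f U)
    {D : ℕ → Set ℂ} (hD : IsPrimeChain U D) (hfD : ∀ n, ∃ m, f '' D m ⊆ D n) :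
    ∃ w ∈ frontier U, f w = w := by
  have hUc : IsPreconnected U := hsc.isPathConnected.isConnected.isPreconnected
  by_contra! hno
  obtain ⟨z, hz, w, hwf, hgates⟩ := hD.exists_gates hU hsc hbdd
  have hw : w ∉ U := by rw [hU.frontier_eq] at hwf; exact hwf.2
  obtain ⟨K, hK, hKU, hKW⟩ := hbnw 1 le_rfl
  have hmaps : ∀ p, f p ∈ U ↔ p ∈ U := fun p => by
    conv_lhs => rw [← hfU]
    exact f.injective.mem_set_image
  have hsz : f.symm z ∈ U := by rw [← hmaps, f.apply_symm_apply]; exact hz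
  obtain ⟨u, v, hu, hv, hwu, hwv, huv⟩ := t2_separation (hno w hwf).symm
  obtain ⟨ρ₀, hρ₀, hball⟩ := Metric.nhds_basis_closedBall.mem_iff.1
    (inter_mem (hu.mem_nhds hwu) (f.continuous.continuousAt.preimage_mem_nhds (hv.mem_nhds hwv)))
  obtain ⟨ρ₁, hρ₁, -, hsub⟩ := exists_subset_sideOf hU hUc hz hw
    (hK.union (isCompact_singleton (x := f.symm z)))
    (union_subset hKU (singleton_subset_iff.2 hsz))
  obtain ⟨x, hxU, hxρ, hxz, m, hm⟩ := hgates _ (lt_min hρ₀ hρ₁)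
  rw [lt_min_iff] at hxρ
  set e := gate U w x with he
  have heB : e ⊆ Metric.closedBall w (dist x w) :=
    gate_subset_sphere.trans Metric.sphere_subset_closedBall
  have hS := hsub e (heB.trans (Metric.closedBall_subset_closedBall hxρ.2.le))
  have hdis : Disjoint (Metric.closedBall w (dist x w)) (f '' Metric.closedBall w (dist x w)) := by
    rw [disjoint_left]
    rintro _ hp ⟨q, hq, rfl⟩
    have hsub := Metric.closedBall_subset_closedBall (x := w) hxρ.1.le
    exact disjoint_left.1 huv (hball (hsub hp)).1 (hball (hsub hq)).2
  have hcut : IsCrossCut U e := isCrossCut_gate hU hsc hbdd hw hxU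
  have heo : IsOpen (U \ e) := hcut.isOpen_diff hU
  have hze : z ∈ U \ e := ⟨hz, fun h => by
    have : dist z w = dist x w := gate_subset_sphere h
    linarith⟩
  have hsec : IsCrossSection U (farSide U e z) := isCrossSection_farSide hcut hze
  have hfe : f '' e ⊆ U \ e := by
    rintro _ ⟨p, hp, rfl⟩
    exact ⟨(hmaps p).2 (gate_subset hp), fun h =>
      disjoint_left.1 hdis (heB h) (mem_image_of_mem _ (heB hp))⟩
  have hxe : x ∈ e := mem_gate hxU
  by_cases hcase : f x ∈ sideOf U e z
  · have hfeS : f '' e ⊆ sideOf U e z := subset_connectedComponentIn_of_mem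
      (isPreconnected_gate.image _ f.continuous.continuousOn) hfe (mem_image_of_mem _ hxe) hcase
    have hMpre : IsPreconnected (U \ sideOf U e z) := isPreconnected_diff_connectedComponentIn hUc
      hcut.isPreconnected hcut.subset hcut.nonempty heo z
    have hM : f.symm '' (U \ sideOf U e z) ⊆ farSide U e z := by
      have hsubU : f.symm '' (U \ sideOf U e z) ⊆ U \ e := by
        rintro _ ⟨p, hp, rfl⟩
        refine ⟨by rw [← hmaps, f.apply_symm_apply]; exact hp.1, fun h => hp.2 (hfeS ⟨_, h, ?_⟩)⟩
        exact f.apply_symm_apply p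
      refine fun p hp => ⟨hsubU hp, fun hpS => ?_⟩
      have hall := subset_connectedComponentIn_of_mem
        (hMpre.image _ f.symm.continuous.continuousOn) hsubU hp hpS
      obtain ⟨m', hm'⟩ := hfD m
      obtain ⟨q, hq⟩ := (hD.1.1 (max m m')).nonempty
      have hq1 := hm (hD.1.2.1 _ _ (le_max_left m m') hq)
      have hq2 := hm (hm' (mem_image_of_mem f (hD.1.2.1 _ _ (le_max_right m m') hq)))
      exact hq1.2 (hall ⟨f q, ⟨hq2.1.1, hq2.2⟩, f.symm_apply_apply q⟩)
    have hdis' : Disjoint (Metric.closedBall w (dist x w))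
        (f.symm '' Metric.closedBall w (dist x w)) := by
      simpa using disjoint_image_symm_iterate f (n := 1) (by simpa using hdis)
    have hfU' : f.symm '' U = U := by
      conv_lhs => rw [← hfU, ← image_comp, f.symm_comp_self, image_id]
    obtain ⟨W, hW, hWn⟩ := exists_section_orbit_disjoint hU hsc hbdd f.symm hfU' hw hxU hz hxz hdis' hM
      (subset_union_left.trans hS)
    obtain ⟨-, k, hk, hkK⟩ := hKW W (isWanderingSection_one f hW fun n hn =>
      disjoint_image_symm_iterate f.symm (hWn n hn).1)
    obtain ⟨n, rfl⟩ := Int.exists_eq_neg_ofNat hk.le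
    rw [iterZ_one_mul_neg_natCast] at hkK
    exact hkK.not_disjoint (hWn n (by omega)).2
  · have hfxE : f x ∈ farSide U e z := ⟨hfe (mem_image_of_mem _ hxe), hcase⟩
    have hfeE : ∀ p ∈ e, f p ∈ farSide U e z := fun p hp =>
      ⟨hfe (mem_image_of_mem _ hp), fun hpS => hcase (subset_connectedComponentIn_of_mem
        (isPreconnected_gate.image _ f.continuous.continuousOn) hfe (mem_image_of_mem _ hp) hpS
        (mem_image_of_mem _ hxe))⟩
    have hsubU : f.symm '' (U \ farSide U e z) ⊆ U \ e := by
      rintro _ ⟨p, hp, rfl⟩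
      refine ⟨by rw [← hmaps, f.apply_symm_apply]; exact hp.1, fun h => hp.2 ?_⟩
      simpa using hfeE _ h
    have hall := subset_connectedComponentIn_of_mem
      ((hsec.isPreconnected_diff hU hUc).image _ f.symm.continuous.continuousOn) hsubU
      (mem_image_of_mem _ (show z ∈ U \ farSide U e z from
        ⟨hz, fun h => h.2 (mem_connectedComponentIn hze)⟩)) (hS (Or.inr rfl))
    have hM : f '' (U \ sideOf U e z) ⊆ farSide U e z := by
      rintro _ ⟨p, hp, rfl⟩
      by_contra hpE
      exact hp.2 (hall ⟨f p, ⟨(hmaps p).2 hp.1, hpE⟩, f.symm_apply_apply p⟩)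
    obtain ⟨W, hW, hWn⟩ := exists_section_orbit_disjoint hU hsc hbdd f hfU hw hxU hz hxz hdis hM
      (subset_union_left.trans hS)
    obtain ⟨⟨k, hk, hkK⟩, -⟩ := hKW W (isWanderingSection_one f hW fun n hn => (hWn n hn).1)
    lift k to ℕ using hk.le
    rw [iterZ_one_mul_natCast] at hkK
    exact hkK.not_disjoint (hWn k (by omega)).2

theorem ChainDivides.trans {D D' D'' : ℕ → Set X} (h : ChainDivides D D') (h' : ChainDivides D' D'') :
    ChainDivides D D'' := fun n => by
  obtain ⟨m, hm⟩ := h' n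
  obtain ⟨k, hk⟩ := h m
  exact ⟨k, hk.trans hm⟩

theorem chainDivides_of_mk_eq {U : Set X} {C C' : PrimeChain U}
    (h : (Quot.mk _ C' : PrimeEnd U) = Quot.mk _ C) : ChainDivides C.1 C'.1 := by
  let P : PrimeEnd U → Prop := Quot.lift (fun C' => ChainDivides C.1 C'.1)
    fun a b hab => propext ⟨fun h => h.trans hab.1, fun h => h.trans hab.2⟩
  have hP : P (Quot.mk _ C) := fun n => ⟨n, subset_rfl⟩
  rw [← h] at hP
  exact hP

/-- A neighborhood of a prime end contains a tail of each of its chains. -/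
theorem exists_subset_of_isOpen_of_mem {U : Set X} (C : PrimeChain U) {O : Set (PrimeEndComp U)}
    (hO : IsOpen O) (hC : peEnd U (Quot.mk _ C) ∈ O) :
    ∃ m, ∀ (x : X) (hx : x ∈ U), x ∈ C.1 m → pePt U ⟨x, hx⟩ ∈ O := by
  have hanti := C.2.1.2.1
  induction hO with
  | basic s hs =>
    rcases hs with ⟨V, -, -, rfl⟩ | ⟨E, -, rfl⟩
    · obtain ⟨x, hx, -⟩ := hC
      cases hx
    · rcases hC with ⟨x, hx, -⟩ | ⟨p, hp, C', hC', N, hN⟩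
      · cases hx
      · cases hp
        obtain ⟨m, hm⟩ := chainDivides_of_mk_eq hC' N
        exact ⟨m, fun x hx hxm => Or.inl ⟨⟨x, hx⟩, rfl, hN N le_rfl (hm hxm)⟩⟩
  | univ => exact ⟨0, fun _ _ _ => mem_univ _⟩
  | inter s t _ _ hs ht =>
    obtain ⟨m, hm⟩ := hs hC.1
    obtain ⟨n, hn⟩ := ht hC.2
    exact ⟨max m n, fun x hx hxm => ⟨hm x hx (hanti _ _ (le_max_left m n) hxm),
      hn x hx (hanti _ _ (le_max_right m n) hxm)⟩⟩
  | sUnion S _ ih =>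
    obtain ⟨s, hs, hCs⟩ := hC
    obtain ⟨m, hm⟩ := ih s hs hCs
    exact ⟨m, fun x hx hxm => ⟨s, hs, hm x hx hxm⟩⟩

theorem exists_invariant_primeChain {U : Set X} {f : X ≃ₜ X} (hfU : f '' U = U)
    {F : PrimeEndComp U ≃ₜ PrimeEndComp U} (hF : IsPEExtension f U F) {p : PrimeEnd U}
    (hp : F (peEnd U p) = peEnd U p) :
    ∃ D, IsPrimeChain U D ∧ ∀ n, ∃ m, f '' D m ⊆ D n := by
  obtain ⟨C, rfl⟩ := Quot.exists_rep p
  refine ⟨C.1, C.2, fun n => ?_⟩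
  have hopen : IsOpen (peSection U (C.1 n)) :=
    TopologicalSpace.isOpen_generateFrom_of_mem (Or.inr ⟨_, C.2.1.1 n, rfl⟩)
  obtain ⟨m, hm⟩ := exists_subset_of_isOpen_of_mem C (hopen.preimage F.continuous) (by
    rw [mem_preimage, hp]
    exact Or.inr ⟨_, rfl, C, rfl, n, fun i hi => C.2.1.2.1 i n hi⟩)
  refine ⟨m, ?_⟩
  rintro _ ⟨x, hx, rfl⟩
  have hxU : x ∈ U := by
    obtain ⟨γ, -, v, -, hv⟩ := C.2.1.1 m
    rw [hv] at hx
    exact (connectedComponentIn_subset _ _ hx).1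
  have hfx : f x ∈ U := hfU ▸ mem_image_of_mem f hxU
  have := hm x hxU hx
  rw [mem_preimage, hF x hxU hfx] at this
  rcases this with ⟨q, hq, hq'⟩ | ⟨q, hq, -⟩
  · cases hq; exact hq'
  · cases hq

section Transport

variable {Y : Type*} [TopologicalSpace Y]

theorem connectedComponentIn_image (e : X ≃ₜ Y) (A : Set X) {x : X} (hx : x ∈ A) :
    connectedComponentIn (e '' A) (e x) = e '' connectedComponentIn A x :=
  (e.image_connectedComponentIn hx).symm

theorem IsCompOf.image (e : X ≃ₜ Y) {A D : Set X} (h : IsCompOf A D) : IsCompOf (e '' A) (e '' D) := by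
  obtain ⟨x, hx, rfl⟩ := h
  exact ⟨e x, mem_image_of_mem e hx, (connectedComponentIn_image e A hx).symm⟩

theorem HasTwoComps.image (e : X ≃ₜ Y) {A D₁ D₂ : Set X} (h : HasTwoComps A D₁ D₂) :
    HasTwoComps (e '' A) (e '' D₁) (e '' D₂) := by
  obtain ⟨h1, h2, hne, h12⟩ := h
  refine ⟨h1.image e, h2.image e, fun h => hne (e.injective.image_injective h), ?_⟩
  rintro _ ⟨x, hx, rfl⟩
  rw [connectedComponentIn_image e A hx]
  exact (h12 x hx).imp (congrArg _) (congrArg _)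

theorem IsCrossCut.image (e : X ≃ₜ Y) {U γ : Set X} (h : IsCrossCut U γ) :
    IsCrossCut (e '' U) (e '' γ) := by
  obtain ⟨g, hc, hi, hg, h0, h1, rfl, D₁, D₂, h12, hD₁, hD₂⟩ := h
  refine ⟨e ∘ g, e.continuous.comp_continuousOn hc, e.injective.comp_injOn hi,
    fun t ht => mem_image_of_mem e (hg t ht), ?_, ?_, (image_comp _ _ _).symm, e '' D₁, e '' D₂, ?_, ?_, ?_⟩
  · rw [← e.image_frontier]; exact mem_image_of_mem e h0
  · rw [← e.image_frontier]; exact mem_image_of_mem e h1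
  · rw [← image_sdiff e.injective]; exact h12.image e
  · rw [← e.image_frontier, ← e.image_frontier, image_comp, ← image_sdiff e.injective,
      ← image_inter e.injective]
    exact hD₁.image e
  · rw [← e.image_frontier, ← e.image_frontier, image_comp, ← image_sdiff e.injective,
      ← image_inter e.injective]
    exact hD₂.image e

theorem IsCrossSection.image (e : X ≃ₜ Y) {U D : Set X} (h : IsCrossSection U D) :
    IsCrossSection (e '' U) (e '' D) := by
  obtain ⟨γ, hγ, hD⟩ := h
  refine ⟨e '' γ, hγ.image e, ?_⟩
  rw [← image_sdiff e.injective]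
  exact hD.image e

theorem bdIn_image (e : X ≃ₜ Y) (U D : Set X) : bdIn (e '' U) (e '' D) = e '' bdIn U D := by
  rw [bdIn, bdIn, ← e.image_closure, ← image_sdiff e.injective, ← image_inter e.injective]

theorem IsPEChain.image (e : X ≃ₜ Y) {U : Set X} {D : ℕ → Set X} (h : IsPEChain U D) :
    IsPEChain (e '' U) fun n => e '' D n := by
  refine ⟨fun i => (h.1 i).image e, fun i j hij => image_mono (h.2.1 i j hij), fun i j hij => ?_⟩
  rw [bdIn_image, bdIn_image, ← e.image_closure, ← e.image_closure, ← image_inter e.injective,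
    h.2.2 i j hij, image_empty]

theorem symm_image_image (e : X ≃ₜ Y) (A : Set X) : e.symm '' (e '' A) = A := by
  rw [← image_comp, e.symm_comp_self, image_id]

theorem IsPrimeChain.image (e : X ≃ₜ Y) {U : Set X} {D : ℕ → Set X} (h : IsPrimeChain U D) :
    IsPrimeChain (e '' U) fun n => e '' D n := by
  refine ⟨h.1.image e, fun D' hD' hdiv n => ?_⟩
  have h1 := hD'.image e.symm
  rw [symm_image_image] at h1
  obtain ⟨m, hm⟩ := h.2 _ h1 (fun n => by
    obtain ⟨m, hm⟩ := hdiv n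
    exact ⟨m, (image_mono hm).trans (symm_image_image e _).subset⟩) n
  refine ⟨m, (image_mono hm).trans ?_⟩
  exact (symm_image_image e.symm _).subset

theorem iterZ_conj (e : X ≃ₜ Y) (f : X ≃ₜ X) (k : ℤ) (A : Set Y) :
    iterZ (e.symm.trans (f.trans e)) k A = e '' iterZ f k (e.symm '' A) := by
  have : (e.symm.trans (f.trans e)).toEquiv ^ k = e.toEquiv.permCongr (f.toEquiv ^ k) :=
    (map_zpow e.toEquiv.permCongrHom f.toEquiv k).symm
  rw [iterZ, iterZ, this, ← image_comp, ← image_comp]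
  rfl

theorem BdNonwandering.conj (e : X ≃ₜ Y) {f : X ≃ₜ X} {U : Set X} (h : BdNonwandering f U) :
    BdNonwandering (e.symm.trans (f.trans e)) (e '' U) := by
  intro n hn
  obtain ⟨K, hK, hKU, hD⟩ := h n hn
  refine ⟨e '' K, hK.image e.continuous, image_mono hKU, fun D hDw => ?_⟩
  have hmeet : ∀ k : ℤ, (iterZ f ((n : ℤ) * k) (e.symm '' D) ∩ K).Nonempty →
      (iterZ (e.symm.trans (f.trans e)) ((n : ℤ) * k) D ∩ e '' K).Nonempty := fun k hk => by
    rw [iterZ_conj, ← image_inter e.injective]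
    exact hk.image e
  obtain ⟨⟨k, hk, hkK⟩, ⟨l, hl, hlK⟩⟩ := hD (e.symm '' D) ⟨by
      have := hDw.1.image e.symm
      rwa [symm_image_image] at this, fun k hk => by
      have := hDw.2 k hk
      rw [iterZ_conj] at this
      apply e.injective.image_injective
      rw [image_inter e.injective, image_empty, ← this]
      congr 1
      exact symm_image_image e.symm D⟩
  exact ⟨⟨k, hk, hmeet k hkK⟩, ⟨l, hl, hmeet l hlK⟩⟩

end Transport

/-- Cartwright–Littlewood under the ∂-nonwandering condition: if `U` is a
bounded open invariant simply connected set, `f` is ∂-nonwandering in `U`, and some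
extension of `f|_U` has a fixed prime end (`ρ(f,U) = 0`), then `f` has a fixed point
on `∂U`. -/
theorem cartwright_littlewood_bd_nonwandering
    (f : (ℝ × ℝ) ≃ₜ (ℝ × ℝ)) (hor : IsOrientationPreserving f)
    (U : Set (ℝ × ℝ)) (hUopen : IsOpen U) (hUbdd : Bornology.IsBounded U)
    (hUinv : ⇑f '' U = U) (hUsc : SimplyConnectedSpace ↥U)
    (hbnw : BdNonwandering f U)
    (hrot : ∃ F : PrimeEndComp U ≃ₜ PrimeEndComp U, IsPEExtension f U F ∧
      ∃ p : PrimeEnd U, F (peEnd U p) = peEnd U p) :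
    ∃ z ∈ frontier U, f z = z := by
  obtain ⟨F, hF, p, hp⟩ := hrot
  obtain ⟨D, hD, hfD⟩ := exists_invariant_primeChain hUinv hF hp
  let e : (ℝ × ℝ) ≃ₜ ℂ := Complex.equivRealProdCLM.toHomeomorph.symm
  have hsc : IsSimplyConnected (e '' U) := e.isSimplyConnected_image.2 hUsc
  have hbdd : Bornology.IsBounded (e '' U) :=
    (hUbdd.isCompact_closure.image e.continuous).isBounded.subset (image_mono subset_closure)
  have himg : ∀ A, e.symm.trans (f.trans e) '' (e '' A) = e '' (f '' A) := fun A => by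
    rw [← image_comp, ← image_comp]
    exact congrArg (· '' A) (funext fun x => by simp)
  obtain ⟨w, hw, hfw⟩ := exists_fixed_of_invariant_primeChain (e.isOpenMap U hUopen) hsc hbdd
    (e.symm.trans (f.trans e)) (by rw [himg, hUinv]) (hbnw.conj e) (hD.image e) (fun n => by
      obtain ⟨m, hm⟩ := hfD n
      exact ⟨m, by rw [himg]; exact image_mono hm⟩)
  rw [← e.image_frontier] at hw
  obtain ⟨q, hq, rfl⟩ := hw
  refine ⟨q, hq, e.injective ?_⟩
  simpa using hfw

end
end

section
/- Let h : ℝ² → ℝ² be an orientation-preserving homeomorphism and γ₀ a simple arc (image of a continuous injective map [0,1] → ℝ²) joining a point z to its image h(z) and containing no fixed point of h. Then every neighborhood of γ₀ contains a translation arc γ for h such that z ∈ γ. -/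
open Set Topology Filter

noncomputable section

universe u

variable {X : Type u} [TopologicalSpace X]

section NormedSpace

variable {E : Type*} [NormedAddCommGroup E] [NormedSpace ℝ E]

theorem exists_homeomorph_apply_center_eq [CompleteSpace E] {c w : E} {r : ℝ}
    (hw : w ∈ Metric.ball c r) :
    ∃ φ : E ≃ₜ E, φ c = w ∧ ∀ x ∉ Metric.ball c r, φ x = x := by
  rcases subsingleton_or_nontrivial E with _ | _
  · exact ⟨Homeomorph.refl E, Subsingleton.elim _ _, fun _ _ => rfl⟩
  have hr : 0 < r := Metric.pos_of_mem_ball hw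
  rw [mem_ball_iff_norm] at hw
  set f : E → E := fun x => x + max 0 (1 - ‖x - c‖ / r) • (w - c)
  have hbump (x y : E) :
      |max 0 (1 - ‖x - c‖ / r) - max 0 (1 - ‖y - c‖ / r)| ≤ ‖x - y‖ / r := by
    refine (abs_max_sub_max_le_max 0 _ 0 _).trans ?_
    rw [sub_self, abs_zero, max_eq_right (abs_nonneg _)]
    have h₁ : 1 - ‖x - c‖ / r - (1 - ‖y - c‖ / r) = (‖y - c‖ - ‖x - c‖) / r := by ring
    rw [h₁, abs_div, abs_of_pos hr]
    gcongr
    simpa [norm_sub_rev] using abs_norm_sub_norm_le (y - c) (x - c)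
  have hf : ApproximatesLinearOn f (ContinuousLinearEquiv.refl ℝ E : E →L[ℝ] E) univ
      (‖w - c‖ / r).toNNReal := by
    intro x _ y _
    have h₁ : f x - f y - (ContinuousLinearEquiv.refl ℝ E : E →L[ℝ] E) (x - y) =
        (max 0 (1 - ‖x - c‖ / r) - max 0 (1 - ‖y - c‖ / r)) • (w - c) := by
      simp only [f, ContinuousLinearEquiv.coe_refl, ContinuousLinearMap.id_apply, sub_smul]
      abel
    rw [h₁, norm_smul, Real.norm_eq_abs, Real.coe_toNNReal _ (by positivity)]
    calc _ ≤ ‖x - y‖ / r * ‖w - c‖ := by gcongr; exact hbump x y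
      _ = _ := by ring
  have hlt : (‖w - c‖ / r).toNNReal <
      ‖((ContinuousLinearEquiv.refl ℝ E).symm : E →L[ℝ] E)‖₊⁻¹ := by
    have h₁ : ‖((ContinuousLinearEquiv.refl ℝ E).symm : E →L[ℝ] E)‖₊ = 1 :=
      NNReal.eq ContinuousLinearMap.norm_id
    rw [h₁, inv_one, Real.toNNReal_lt_one, div_lt_one hr]
    exact hw
  refine ⟨hf.toHomeomorph f (Or.inr hlt), ?_, fun x hx => ?_⟩
  · change f c = w
    simp [f]
  · change f x = x
    rw [mem_ball_iff_norm, not_lt] at hx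
    have h₁ : 1 - ‖x - c‖ / r ≤ 0 := by
      rw [sub_nonpos, one_le_div hr]
      exact hx
    simp [f, max_eq_left h₁]

theorem exists_homeomorph_fixing_apply_mem_ball [CompleteSpace E] {K V : Set E} {z : E} {ε : ℝ}
    (hε : 0 < ε) (hK : IsPreconnected K) (hV : IsOpen V) (hKV : K ⊆ V) (hz : z ∈ K)
    {w : E} (hw : w ∈ K) (hwz : w ≠ z) :
    ∃ φ : E ≃ₜ E, φ z = z ∧ (∀ x ∉ V, φ x = x) ∧ φ w ∈ Metric.ball z ε := by
  set T : Set E := {w | w = z ∨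
    ∃ φ : E ≃ₜ E, φ z = z ∧ (∀ x ∉ V, φ x = x) ∧ φ w ∈ Metric.ball z ε}
  have hball {w : E} (hwV : w ∈ V) (hwz : w ≠ z) :
      ∃ r > 0, Metric.ball w r ⊆ V ∩ {z}ᶜ :=
    Metric.isOpen_iff.1 (hV.inter isOpen_compl_singleton) w ⟨hwV, hwz⟩
  have hopen : V ∩ T ⊆ interior T := by
    rintro w ⟨hwV, hwT⟩
    rw [mem_interior_iff_mem_nhds]
    by_cases hwz : w = z
    · subst hwz
      filter_upwards [Metric.ball_mem_nhds w hε] with v hv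
      exact Or.inr ⟨Homeomorph.refl E, rfl, fun _ _ => rfl, hv⟩
    · obtain ⟨φ, hφz, hφV, hφw⟩ := hwT.resolve_left hwz
      obtain ⟨r, hr, hrV⟩ := hball hwV hwz
      filter_upwards [Metric.ball_mem_nhds w hr] with v hv
      obtain ⟨ψ, hψw, hψ⟩ := exists_homeomorph_apply_center_eq hv
      have hψ' : ∀ x ∉ Metric.ball w r, ψ.symm x = x := fun x hx => by
        rw [Homeomorph.symm_apply_eq, hψ x hx]
      refine Or.inr ⟨ψ.symm.trans φ, ?_, fun x hx => ?_, ?_⟩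
      · rw [Homeomorph.trans_apply, hψ' z fun hzr => (hrV hzr).2 rfl, hφz]
      · rw [Homeomorph.trans_apply, hψ' x fun hxr => hx (hrV hxr).1, hφV x hx]
      · rwa [Homeomorph.trans_apply, ← hψw, Homeomorph.symm_apply_apply]
  have hclosed : closure (interior T) ∩ K ⊆ interior T := by
    rintro w ⟨hwT, hwK⟩
    refine hopen ⟨hKV hwK, ?_⟩
    by_cases hwz : w = z
    · exact Or.inl hwz
    obtain ⟨r, hr, hrV⟩ := hball (hKV hwK) hwz
    obtain ⟨v, hvT, hv⟩ := Metric.mem_closure_iff.1 hwT r hr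
    rw [dist_comm, ← Metric.mem_ball] at hv
    obtain ⟨φ, hφz, hφV, hφv⟩ := (interior_subset hvT).resolve_left (hrV hv).2
    obtain ⟨ψ, hψw, hψ⟩ := exists_homeomorph_apply_center_eq hv
    refine Or.inr ⟨ψ.trans φ, ?_, fun x hx => ?_, ?_⟩
    · rw [Homeomorph.trans_apply, hψ z fun hzr => (hrV hzr).2 rfl, hφz]
    · rw [Homeomorph.trans_apply, hψ x fun hxr => hx (hrV hxr).1, hφV x hx]
    · rwa [Homeomorph.trans_apply, hψw]
  have hKT : K ⊆ interior T :=
    hK.subset_of_closure_inter_subset isOpen_interior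
      ⟨z, hz, hopen ⟨hKV hz, Or.inl rfl⟩⟩ hclosed
  exact (interior_subset (hKT hw)).resolve_left hwz

theorem Homeomorph.apply_notMem_ball_of_mem_closedBall {h : E ≃ₜ E} {z : E} {r : ℝ} (hr : r ≠ 0)
    (hh : ∀ x ∈ Metric.ball z r, h x ∉ Metric.ball z r) {x : E}
    (hx : x ∈ Metric.closedBall z r) : h x ∉ Metric.ball z r := by
  have hdisj : Disjoint (h ⁻¹' Metric.ball z r) (Metric.ball z r) :=
    disjoint_left.2 fun y hy hy' => hh y hy' hy
  rw [← closure_ball z hr] at hx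
  exact fun hx' => disjoint_left.1
    (hdisj.closure_right (Metric.isOpen_ball.preimage h.continuous)) hx' hx

/-- Among all balls centred at `z`, the first one to meet its image does so on its boundary. -/
theorem Homeomorph.exists_first_contact_radius [ProperSpace E] (h : E ≃ₜ E) {z : E}
    (hz : h z ≠ z) :
    ∃ r > 0, r ≤ dist (h z) z ∧
      (∀ x ∈ Metric.closedBall z r, h x ∉ Metric.ball z r) ∧
      (∀ x ∈ Metric.ball z r, h x ∉ Metric.closedBall z r) ∧
      ∃ x, dist x z = r ∧ dist (h x) z = r := by
  set F : E → ℝ := fun x => max (dist x z) (dist (h x) z) with hF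
  obtain ⟨x, -, hx⟩ := (isCompact_closedBall z (dist (h z) z)).exists_isMinOn
    ⟨z, Metric.mem_closedBall_self dist_nonneg⟩
    (show ContinuousOn F _ by fun_prop)
  have hFz : F z = dist (h z) z := by simp [hF]
  have hxz : F x ≤ dist (h z) z :=
    hFz ▸ hx (Metric.mem_closedBall_self dist_nonneg)
  have hmin (y : E) : F x ≤ F y := by
    by_cases hy : y ∈ Metric.closedBall z (dist (h z) z)
    · exact hx hy
    · rw [Metric.mem_closedBall, not_le] at hy
      exact hxz.trans (hy.le.trans (le_max_left _ _))
  have hpos : 0 < F x := by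
    by_contra! hle
    have h₁ : x = z := dist_le_zero.1 ((le_max_left _ _).trans hle)
    have h₂ : h x = z := dist_le_zero.1 ((le_max_right _ _).trans hle)
    exact hz (h₁ ▸ h₂.trans h₁.symm)
  have hball : ∀ y ∈ Metric.ball z (F x), h y ∉ Metric.ball z (F x) := fun y hy hy' =>
    (hmin y).not_gt (max_lt hy hy')
  have hball_symm : ∀ y ∈ Metric.ball z (F x), h.symm y ∉ Metric.ball z (F x) := fun y hy hy' =>
    hball _ hy' (by rwa [h.apply_symm_apply])
  have hclosed : ∀ y ∈ Metric.closedBall z (F x), h y ∉ Metric.ball z (F x) := fun y hy =>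
    apply_notMem_ball_of_mem_closedBall hpos.ne' hball hy
  have hclosed' : ∀ y ∈ Metric.ball z (F x), h y ∉ Metric.closedBall z (F x) := fun y hy hy' =>
    apply_notMem_ball_of_mem_closedBall hpos.ne' hball_symm hy' (by rwa [h.symm_apply_apply])
  have hx₁ : dist x z ≤ F x := le_max_left _ _
  have hx₂ : dist (h x) z ≤ F x := le_max_right _ _
  exact ⟨F x, hpos, hxz, hclosed, hclosed', x,
    hx₁.eq_of_not_lt fun hlt => hclosed' x hlt hx₂,
    hx₂.eq_of_not_lt fun hlt => hclosed x hx₁ hlt⟩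

/-- Two radii of a ball with distinct endpoints on the sphere form an arc through the centre. -/
theorem exists_arc_of_dist_eq {x y z : E} {r : ℝ} (hr : 0 < r) (hxy : x ≠ y)
    (hx : dist x z = r) (hy : dist y z = r) :
    ∃ g : ℝ → E, Continuous g ∧ InjOn g (Icc 0 1) ∧ g 0 = x ∧ g 1 = y ∧ z ∈ g '' Icc 0 1 ∧
      g '' Icc 0 1 ⊆ Metric.closedBall z r ∧
      ∀ p ∈ g '' Icc 0 1, p ∉ Metric.ball z r → p = x ∨ p = y := by
  set g : ℝ → E := fun t => z + (max (1 - 2 * t) 0 • (x - z) + max (2 * t - 1) 0 • (y - z))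
  rw [dist_eq_norm] at hx hy
  have hleft {t : ℝ} (ht : t ≤ 1 / 2) : g t = z + (1 - 2 * t) • (x - z) := by
    simp only [g]
    rw [max_eq_left (by linarith), max_eq_right (by linarith), zero_smul, add_zero]
  have hright {t : ℝ} (ht : 1 / 2 ≤ t) : g t = z + (2 * t - 1) • (y - z) := by
    simp only [g]
    rw [max_eq_right (by linarith), max_eq_left (by linarith), zero_smul, zero_add]
  have hg0 : g 0 = x := by simp [hleft]
  have hg1 : g 1 = y := by rw [hright (by norm_num)]; norm_num
  have hdist (t : ℝ) : dist (g t) z = |2 * t - 1| * r := by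
    rcases le_total t (1 / 2) with ht | ht
    · rw [hleft ht, dist_eq_norm, add_sub_cancel_left, norm_smul, hx, Real.norm_eq_abs,
        abs_sub_comm]
    · rw [hright ht, dist_eq_norm, add_sub_cancel_left, norm_smul, hy, Real.norm_eq_abs]
  have hcross {s t : ℝ} (hs : s ≤ 1 / 2) (ht : 1 / 2 ≤ t) (hst : g s = g t) : s = t := by
    have habs : 1 - 2 * s = 2 * t - 1 := by
      have h₁ := hdist s
      rw [hst, hdist t, mul_left_inj' hr.ne', abs_of_nonneg (by linarith),
        abs_of_nonpos (by linarith)] at h₁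
      linarith
    rw [hleft hs, hright ht, habs, add_right_inj] at hst
    by_contra hne
    have h₁ : 2 * t - 1 ≠ 0 := fun h₁ => hne (by linarith)
    exact hxy (sub_left_injective (smul_right_injective E h₁ hst))
  refine ⟨g, by fun_prop, ?_, hg0, hg1, ⟨1 / 2, by norm_num, ?_⟩, ?_, ?_⟩
  · intro s _ t _ hst
    have habs : |2 * s - 1| = |2 * t - 1| := by
      have h₁ := hdist s
      rw [hst, hdist t, mul_left_inj' hr.ne'] at h₁
      exact h₁.symm
    rcases le_total s (1 / 2) with hs | hs <;> rcases le_total t (1 / 2) with ht | ht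
    · rw [abs_of_nonpos (by linarith), abs_of_nonpos (by linarith)] at habs
      linarith
    · exact hcross hs ht hst
    · exact (hcross ht hs hst.symm).symm
    · rw [abs_of_nonneg (by linarith), abs_of_nonneg (by linarith)] at habs
      linarith
  · simp [g]
  · rintro _ ⟨t, ⟨ht0, ht1⟩, rfl⟩
    rw [Metric.mem_closedBall, hdist]
    exact mul_le_of_le_one_left hr.le (abs_le.2 ⟨by linarith, by linarith⟩)
  · rintro _ ⟨t, ⟨ht0, ht1⟩, rfl⟩ hp
    rw [Metric.mem_ball, hdist, not_lt] at hp
    have h₁ : 1 ≤ |2 * t - 1| := le_of_mul_le_mul_right (by simpa using hp) hr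
    rcases le_abs.1 h₁ with h₂ | h₂
    · right
      rw [← hg1, show t = 1 by linarith]
    · left
      rw [← hg0, show t = 0 by linarith]

/-- If `h` has no fixed point in the ball of radius `dist (h z) z` around `z`, then that ball
contains a translation arc through `z`. -/
theorem Homeomorph.exists_isTranslationArc_subset_closedBall [ProperSpace E] (h : E ≃ₜ E) {z : E}
    (hfix : ∀ x ∈ Metric.closedBall z (dist (h z) z), h x ≠ x) :
    ∃ (γ : Set E) (x : E), IsTranslationArc h γ x ∧
      γ ⊆ Metric.closedBall z (dist (h z) z) ∧ z ∈ γ := by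
  obtain ⟨r, hr, hrz, hclosed, hclosed', x, hx, hhx⟩ :=
    h.exists_first_contact_radius (hfix z (Metric.mem_closedBall_self dist_nonneg))
  have hne : h x ≠ x := hfix x (hx.le.trans hrz)
  obtain ⟨g, hgc, hginj, hg0, hg1, hzg, hgball, hgend⟩ :=
    exists_arc_of_dist_eq hr hne.symm hx hhx
  have hx_mem : x ∈ g '' Icc 0 1 := ⟨0, by simp, hg0⟩
  have hhx_mem : h x ∈ g '' Icc 0 1 := ⟨1, by simp, hg1⟩
  have hinter {q : E} (hq : q ∈ g '' Icc 0 1) (hhq : h q ∈ g '' Icc 0 1) :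
      h q = h x ∨ h q = x ∧ h (h x) = x := by
    have h₁ := hgend _ hhq (hclosed q (hgball hq))
    rcases hgend q hq fun hqb => hclosed' q hqb (hgball hhq) with rfl | rfl
    · exact Or.inl rfl
    · rcases h₁ with h₁ | h₁
      · exact Or.inr ⟨h₁, h₁⟩
      · exact Or.inl h₁
  refine ⟨g '' Icc 0 1, x, ⟨hne, g, hgc.continuousOn, hginj, hg0, hg1, rfl, ?_⟩,
    hgball.trans (Metric.closedBall_subset_closedBall hrz), hzg⟩
  by_cases hper : h (h x) = x
  · refine Or.inr ⟨Subset.antisymm ?_ ?_, hper⟩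
    · rintro _ ⟨⟨q, hq, rfl⟩, hhq⟩
      exact (hinter hq hhq).elim Or.inr fun h₁ => Or.inl h₁.1
    · rintro _ (rfl | rfl)
      · exact ⟨⟨_, hhx_mem, hper⟩, hx_mem⟩
      · exact ⟨mem_image_of_mem h hx_mem, hhx_mem⟩
  · refine Or.inl (Subset.antisymm ?_ ?_)
    · rintro _ ⟨⟨q, hq, rfl⟩, hhq⟩
      exact (hinter hq hhq).resolve_right fun h₁ => hper h₁.2
    · rintro _ rfl
      exact ⟨mem_image_of_mem h hx_mem, hhx_mem⟩

end NormedSpace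

theorem IsTranslationArc.conj {f : X ≃ₜ X} {γ : Set X} {x : X}
    (φ : X ≃ₜ X) (hγ : IsTranslationArc ((φ.symm.trans f).trans φ) γ x) :
    IsTranslationArc f (φ.symm '' γ) (φ.symm x) := by
  obtain ⟨hne, g, hgc, hginj, hg0, hg1, rfl, hint⟩ := hγ
  set γ := g '' Icc 0 1
  have himage : f '' (φ.symm '' γ) = φ.symm '' (((φ.symm.trans f).trans φ) '' γ) := by
    simp [image_image]
  simp only [Homeomorph.trans_apply] at hne hg1 hint
  refine ⟨fun h => hne (by rw [h, φ.apply_symm_apply]), φ.symm ∘ g,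
    φ.symm.continuous.comp_continuousOn hgc, φ.symm.injective.comp_injOn hginj, ?_, ?_, ?_, ?_⟩
  · rw [Function.comp_apply, hg0]
  · rw [Function.comp_apply, hg1, φ.symm_apply_apply]
  · rw [image_comp]
  · rw [himage, ← image_inter φ.symm.injective]
    rcases hint with h₁ | ⟨h₁, h₂⟩
    · left
      rw [h₁, image_singleton, φ.symm_apply_apply]
    · right
      rw [h₁, image_pair, φ.symm_apply_apply]
      refine ⟨rfl, φ.injective ?_⟩
      simpa using h₂

/-- Any simple arc joining a point `z` to its image `h z` and containing no
fixed point of `h` has, in each of its neighborhoods, a translation arc for `h` passing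
through `z`. -/
theorem translation_arc_near_simple_arc
    (h : (ℝ × ℝ) ≃ₜ (ℝ × ℝ)) (hor : IsOrientationPreserving h)
    (z : ℝ × ℝ) (g : ℝ → ℝ × ℝ)
    (hgc : ContinuousOn g (Icc 0 1)) (hginj : InjOn g (Icc 0 1))
    (hg0 : g 0 = z) (hg1 : g 1 = h z)
    (hnofix : ∀ t ∈ Icc (0:ℝ) 1, h (g t) ≠ g t)
    (V : Set (ℝ × ℝ)) (hV : V ∈ 𝓝ˢ (g '' Icc 0 1)) :
    ∃ (γ : Set (ℝ × ℝ)) (x : ℝ × ℝ), IsTranslationArc h γ x ∧ γ ⊆ V ∧ z ∈ γ := by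
  set K : Set (ℝ × ℝ) := g '' Icc 0 1
  set U : Set (ℝ × ℝ) := interior V ∩ {x | h x ≠ x}
  have hU : IsOpen U := isOpen_interior.inter (isOpen_ne_fun h.continuous continuous_id)
  have hKU : K ⊆ U := by
    refine subset_inter (subset_interior_iff_mem_nhdsSet.2 hV) ?_
    rintro _ ⟨t, ht, rfl⟩
    exact hnofix t ht
  have hzK : z ∈ K := ⟨0, by simp, hg0⟩
  have hhzK : h z ∈ K := ⟨1, by simp, hg1⟩
  obtain ⟨ε, hε, hball⟩ := Metric.isOpen_iff.1 hU z (hKU hzK)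
  obtain ⟨φ, hφz, hφU, hφhz⟩ := exists_homeomorph_fixing_apply_mem_ball hε
    (isPreconnected_Icc.image g hgc) hU hKU hzK hhzK (hKU hzK).2
  have hφz' : φ.symm z = z := by rw [Homeomorph.symm_apply_eq, hφz]
  set k := (φ.symm.trans h).trans φ with hk
  have hkz : k z = φ (h z) := by simp [hk, hφz']
  have hsubset : Metric.closedBall z (dist (k z) z) ⊆ φ.symm ⁻¹' U := by
    intro x hx
    have hxU : x ∈ U := hball ((Metric.mem_closedBall.1 hx).trans_lt (hkz ▸ hφhz))
    by_contra hx'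
    have h₁ := hφU (φ.symm x) hx'
    rw [φ.apply_symm_apply] at h₁
    rw [mem_preimage, ← h₁] at hx'
    exact hx' hxU
  obtain ⟨γ, x, hγ, hγball, hzγ⟩ :=
    k.exists_isTranslationArc_subset_closedBall (z := z) fun x hx hxk =>
      (hsubset hx).2 (φ.injective (by simpa [hk] using hxk))
  refine ⟨φ.symm '' γ, φ.symm x, hγ.conj φ, ?_, z, hzγ, hφz'⟩
  rintro _ ⟨y, hy, rfl⟩
  exact interior_subset (hsubset (hγball hy)).1

end
end
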